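/- Let (X, π) be a weighted simplicial complex of rank n and 0 ≤ ℓ ≤ n. For a face ω̂ of X and 1 ≤ k ≤ n−|ω̂|, set π*_{ω̂,k} = min_{ω̃ ∈ X_ω̂^(k)} π^(ω̂)_k(ω̃), and let C_{ω̂,k} = 1 if π*_{ω̂,k} > 1/2 and C_{ω̂,k} = (1 − 2π*_{ω̂,k})/log(1/π*_{ω̂,k} − 1) otherwise. Then: (1) LS(Duw_{n↔ℓ}) ≥ (min_{ω̂ ∈ X^(ℓ)} C_{ω̂, n−ℓ}) · EC(Up_{ℓ→n}); (2) LS(Udw_{n−1↔n}) ≥ ((n−1)/n) · (min_{ω̂ ∈ X^(n−2)} C_{ω̂,1}) · Gap_{n−2}(X, π) · EC(Up_{n−2→n−1}). -/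

import Mathlib

open scoped Classical
noncomputable section

namespace Expanderized

/-! ## Generic weighted linear algebra over finite types -/

section Generic

variable {α β γ : Type*}

/-- Inner product `⟨f,g⟩_μ = E_{x∼μ}[f(x)g(x)]` with respect to a weight `μ`. -/
def inner' [Fintype α] (μ : α → ℝ) (f g : α → ℝ) : ℝ := ∑ x, μ x * (f x * g x)

/-- Expectation with respect to `μ`. -/
def expect [Fintype α] (μ : α → ℝ) (f : α → ℝ) : ℝ := ∑ x, μ x * f x

/-- `μ` is a probability distribution. -/
def IsProbDist [Fintype α] (μ : α → ℝ) : Prop := (∀ x, 0 ≤ μ x) ∧ (∑ x, μ x) = 1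

/-- A row-stochastic kernel. -/
def IsRowStochastic [Fintype β] (P : α → β → ℝ) : Prop :=
  (∀ x y, 0 ≤ P x y) ∧ ∀ x, (∑ y, P x y) = 1

/-- Product of two kernels (matrix multiplication). -/
def matMul [Fintype β] (A : α → β → ℝ) (B : β → γ → ℝ) : α → γ → ℝ :=
  fun x z => ∑ y, A x y * B y z

/-- Right action of a kernel on a function (column vector). -/
def mApp [Fintype β] (A : α → β → ℝ) (f : β → ℝ) : α → ℝ :=
  fun x => ∑ y, A x y * f y

/-- Left action of a kernel on a row vector / measure. -/
def rowMul [Fintype α] (μ : α → ℝ) (A : α → β → ℝ) : β → ℝ :=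
  fun y => ∑ x, μ x * A x y

/-- The adjoint of the kernel `P` with respect to the measures `(μ₁, μ₂)`. -/
def adjointKer [Fintype α] [Fintype β] (μ₁ : α → ℝ) (μ₂ : β → ℝ) (P : α → β → ℝ) :
    β → α → ℝ :=
  fun y x => P x y * μ₁ x / μ₂ y

/-- Iterates of a square kernel. -/
def matIter [Fintype α] [DecidableEq α] (A : α → α → ℝ) : ℕ → (α → α → ℝ)
  | 0 => fun x y => if x = y then 1 else 0
  | (t + 1) => matMul (matIter A t) A

/-- The second-largest eigenvalue `λ₂` of a random walk matrix that is reversible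
with respect to `μ`, via its Rayleigh-quotient (Courant–Fischer) characterization. -/
def lambda2 [Fintype α] (μ : α → ℝ) (A : α → α → ℝ) : ℝ :=
  sSup {r | ∃ f : α → ℝ, inner' μ f f = 1 ∧ inner' μ f (fun _ => 1) = 0 ∧
      r = inner' μ f (mApp A f)}

/-- The spectral gap `1 - λ₂`. -/
def specGap [Fintype α] (μ : α → ℝ) (A : α → α → ℝ) : ℝ := 1 - lambda2 μ A

/-- The two-sided expansion `λ(A) = max(λ₂(A), |λ_min(A)|)` of a random walk matrix
reversible with respect to `μ`, via its Rayleigh-quotient characterization. -/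
def twoSided [Fintype α] (μ : α → ℝ) (A : α → α → ℝ) : ℝ :=
  sSup {r | ∃ f : α → ℝ, inner' μ f f = 1 ∧ inner' μ f (fun _ => 1) = 0 ∧
      r = |inner' μ f (mApp A f)|}

/-- The operator norm `‖A‖_{op,μ}`. -/
def opNorm [Fintype α] (μ : α → ℝ) (A : α → α → ℝ) : ℝ :=
  sSup {r | ∃ f : α → ℝ, inner' μ f f = 1 ∧
      r = Real.sqrt (inner' μ (mApp A f) (mApp A f))}

/-- The `Φ`-entropy functional `Ent^Φ_μ(f) = E_μ[Φ(f)] - Φ(E_μ f)`. -/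
def phiEnt [Fintype α] (Φ : ℝ → ℝ) (μ : α → ℝ) (f : α → ℝ) : ℝ :=
  expect μ (fun x => Φ (f x)) - Φ (expect μ f)

/-- `t ↦ t log t`; note `Real.log 0 = 0`, so the convention `0 log 0 = 0` is built in. -/
def nlog (t : ℝ) : ℝ := t * Real.log t

/-- The usual entropy functional `Ent_μ`. -/
def ent [Fintype α] (μ : α → ℝ) (f : α → ℝ) : ℝ := phiEnt nlog μ f

/-- The `Φ`-entropy contraction constant of a kernel `P` with respect to measures
`(μ₁, μ₂)`: the largest `C ≥ 0` such that `Ent^Φ_{μ₁}(Pf) ≤ (1-C)·Ent^Φ_{μ₂}(f)`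
for all nonnegative `f`. -/
def CFphi [Fintype α] [Fintype β] (Φ : ℝ → ℝ) (μ₁ : α → ℝ) (μ₂ : β → ℝ)
    (P : α → β → ℝ) : ℝ :=
  sSup {C | 0 ≤ C ∧ ∀ f : β → ℝ, (∀ y, 0 ≤ f y) →
      phiEnt Φ μ₁ (mApp P f) ≤ (1 - C) * phiEnt Φ μ₂ f}

/-- The entropy contraction constant `EC(P)`. -/
def EC [Fintype α] [Fintype β] (μ₁ : α → ℝ) (μ₂ : β → ℝ) (P : α → β → ℝ) : ℝ :=
  CFphi nlog μ₁ μ₂ P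

/-- The log-Sobolev constant of a reversible kernel `P` with stationary measure `μ`:
the largest `C ≥ 0` with `C·Ent_μ(f²) ≤ ⟨f,(I-P)f⟩_μ` for all nonnegative `f`. -/
def LS [Fintype α] (μ : α → ℝ) (P : α → α → ℝ) : ℝ :=
  sSup {C | 0 ≤ C ∧ ∀ f : α → ℝ, (∀ x, 0 ≤ f x) →
      C * ent μ (fun x => f x ^ 2) ≤ inner' μ f (fun x => f x - mApp P f x)}

/-- The modified log-Sobolev constant of a reversible kernel `P` with stationary
measure `μ`: the largest `C ≥ 0` with `C·Ent_μ(f) ≤ ⟨f,(I-P) log f⟩_μ`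
for all strictly positive `f`. -/
def MLS [Fintype α] (μ : α → ℝ) (P : α → α → ℝ) : ℝ :=
  sSup {C | 0 ≤ C ∧ ∀ f : α → ℝ, (∀ x, 0 < f x) →
      C * ent μ f ≤
        inner' μ f (fun x => Real.log (f x) - mApp P (fun y => Real.log (f y)) x)}

/-- Total variation distance. -/
def tvDist [Fintype α] (μ ν : α → ℝ) : ℝ := (∑ x, |μ x - ν x|) / 2

/-- The `ε`-mixing time of a kernel `P` towards the target distribution `π`. -/
def mixingTime [Fintype α] [DecidableEq α] (P : α → α → ℝ) (π : α → ℝ) (ε : ℝ) : ℕ :=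
  sInf {t : ℕ | ∀ μ₀ : α → ℝ, IsProbDist μ₀ → tvDist (rowMul μ₀ (matIter P t)) π ≤ ε}

end Generic

/-! ## Weighted simplicial complexes -/

/-- A weighted (pure) simplicial complex of rank `n` on a finite vertex set `V`:
a downward-closed collection of faces, all maximal faces of cardinality `n`,
together with a fully supported probability distribution `pi` on the rank `n` faces
(extended by zero to all finsets). -/
structure WComplex (V : Type*) [Fintype V] [DecidableEq V] (n : ℕ) where
  faces : Finset (Finset V)
  pi : Finset V → ℝ
  faces_nonempty : faces.Nonempty
  down_closed : ∀ α ∈ faces, ∀ β ⊆ α, β ∈ faces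
  card_le : ∀ α ∈ faces, α.card ≤ n
  pure : ∀ α ∈ faces, ∃ ω ∈ faces, ω.card = n ∧ α ⊆ ω
  pi_pos : ∀ ω ∈ faces, ω.card = n → 0 < pi ω
  pi_zero_of_not_mem : ∀ ω : Finset V, ω ∉ faces → pi ω = 0
  pi_zero_of_card_ne : ∀ ω : Finset V, ω.card ≠ n → pi ω = 0
  pi_sum : (∑ ω : Finset V, pi ω) = 1

namespace WComplex

variable {V : Type*} [Fintype V] [DecidableEq V] {n : ℕ}

/-- `Pr_{ω∼π}[ω ⊇ α]` (unnormalized level mass of a face). -/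
def mass (K : WComplex V n) (α : Finset V) : ℝ :=
  ∑ ω : Finset V, if α ⊆ ω then K.pi ω else 0

/-- The induced distribution `π_j` on the `j`-th level `X^(j)`. -/
def level (K : WComplex V n) (j : ℕ) : Finset V → ℝ :=
  fun α => if α.card = j then ((n.choose j : ℝ))⁻¹ * K.mass α else 0

/-- The up-walk `Up_{ℓ→k}`. -/
def up (K : WComplex V n) (ℓ k : ℕ) : Finset V → Finset V → ℝ :=
  fun a b =>
    if a.card = ℓ ∧ b.card = k ∧ a ⊆ b then
      (((n - ℓ).choose (k - ℓ) : ℝ))⁻¹ * (K.mass b / K.mass a)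
    else 0

/-- The down-walk `Down_{k→ℓ}`. -/
def down (K : WComplex V n) (k ℓ : ℕ) : Finset V → Finset V → ℝ :=
  fun a b => if a.card = k ∧ b.card = ℓ ∧ b ⊆ a then ((k.choose ℓ : ℝ))⁻¹ else 0

/-- The down-up walk `Duw_{n↔ℓ} = Down_{n→ℓ}·Up_{ℓ→n}` on `X^(n)`. -/
def downUp (K : WComplex V n) (ℓ : ℕ) : Finset V → Finset V → ℝ :=
  matMul (K.down n ℓ) (K.up ℓ n)

/-- The up-down walk `Udw_{ℓ↔n} = Up_{ℓ→n}·Down_{n→ℓ}` on `X^(ℓ)`. -/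
def upDown (K : WComplex V n) (ℓ : ℕ) : Finset V → Finset V → ℝ :=
  matMul (K.up ℓ n) (K.down n ℓ)

/-- The top-level distribution `π^(ω̂)` of the link complex of the face `z`. -/
def linkPi (K : WComplex V n) (z : Finset V) : Finset V → ℝ :=
  fun α => if Disjoint α z then K.pi (z ∪ α) / K.mass z else 0

/-- Unnormalized level mass in the link of `z`. -/
def linkMass (K : WComplex V n) (z α : Finset V) : ℝ :=
  ∑ β : Finset V, if α ⊆ β then K.linkPi z β else 0

/-- The induced distribution `π^(ω̂)_j` on the `j`-th level of the link of `z`. -/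
def linkLevel (K : WComplex V n) (z : Finset V) (j : ℕ) : Finset V → ℝ :=
  fun α => if α.card = j then (((n - z.card).choose j : ℝ))⁻¹ * K.linkMass z α else 0

/-- The up-walk `Up^{ω̂}_{ℓ→k}` of the link complex of `z`. -/
def linkUp (K : WComplex V n) (z : Finset V) (ℓ k : ℕ) : Finset V → Finset V → ℝ :=
  fun a b =>
    if a.card = ℓ ∧ b.card = k ∧ a ⊆ b then
      ((((n - z.card) - ℓ).choose (k - ℓ) : ℝ))⁻¹ * (K.linkMass z b / K.linkMass z a)
    else 0

/-- The vertex marginal `π^(ω̂)_1` of the link of `z`, as a distribution on vertices. -/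
def linkVertex (K : WComplex V n) (z : Finset V) : V → ℝ :=
  fun x => K.linkLevel z 1 {x}

/-- The link random-walk matrix `M_ω̂` of a face `z` (with `|z| ≤ n-2`). -/
def linkMat (K : WComplex V n) (z : Finset V) : V → V → ℝ :=
  fun x y =>
    if x ≠ y then (K.mass (z ∪ {x, y}) / K.mass (z ∪ {x})) / ((n : ℝ) - z.card - 1)
    else 0

/-- The local `Φ`-entropy contraction constant `lc_Φ(ω̂)`: the smallest `c ≥ 0` with
`Ent^Φ_{π^(ω̂)_1}(Up^{ω̂}_{1→n'} g) ≤ c·Ent^Φ_{π^(ω̂)_{n'}}(g)` for all `g ≥ 0`,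
where `n' = n - |ω̂|`. -/
def lcPhi (K : WComplex V n) (Φ : ℝ → ℝ) (z : Finset V) : ℝ :=
  sInf {c | 0 ≤ c ∧ ∀ g : Finset V → ℝ, (∀ x, 0 ≤ g x) →
      phiEnt Φ (K.linkLevel z 1) (mApp (K.linkUp z 1 (n - z.card)) g)
        ≤ c * phiEnt Φ (K.linkLevel z (n - z.card)) g}

/-- The local entropy contraction constant `lec(ω̂)` (the case `Φ(t) = t log t`). -/
def lec (K : WComplex V n) (z : Finset V) : ℝ := K.lcPhi nlog z

end WComplex

/-! ## Partite complexes, auxiliary expander graphs, and expanderized walks -/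

section Partite

variable {n : ℕ} {U : Type*} [Fintype U] [DecidableEq U]

/-- The type of a face of an `n`-partite complex: the set of sides it meets. -/
def typ (α : Finset (Fin n × U)) : Finset (Fin n) := α.image Prod.fst

/-- The restriction `ω_S` of a face to the sides in `S`. -/
def restrict (ω : Finset (Fin n × U)) (S : Finset (Fin n)) : Finset (Fin n × U) :=
  ω.filter fun v => v.1 ∈ S

/-- An `n`-partite complex: every facet contains exactly one vertex from each side. -/
def IsPartite (K : WComplex (Fin n × U) n) : Prop :=
  ∀ ω ∈ K.faces, ω.card = n → (typ ω).card = n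

/-- `H` is a `k`-regular graph all of whose edges join `ℓ`-element subsets of `[n]`. -/
def IsRegularOnSubsets (H : SimpleGraph (Finset (Fin n))) (ℓ k : ℕ) : Prop :=
  (∀ S T, H.Adj S T → S.card = ℓ ∧ T.card = ℓ) ∧
  (∀ S : Finset (Fin n), S.card = ℓ → (Finset.univ.filter fun T => H.Adj S T).card = k)

/-- The simple random walk matrix of a `k`-regular graph `H`. -/
def walkMat (H : SimpleGraph (Finset (Fin n))) (k : ℕ) :
    Finset (Fin n) → Finset (Fin n) → ℝ :=
  fun S T => if H.Adj S T then (k : ℝ)⁻¹ else 0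

/-- The uniform distribution on `ℓ`-element subsets of `[n]`. -/
def unifSubsets (n ℓ : ℕ) : Finset (Fin n) → ℝ :=
  fun S => if S.card = ℓ then ((n.choose ℓ : ℝ))⁻¹ else 0

/-- The two-sided expansion `λ(H)` of `H`. -/
def lamH (H : SimpleGraph (Finset (Fin n))) (ℓ k : ℕ) : ℝ :=
  twoSided (unifSubsets n ℓ) (walkMat H k)

/-- The two-sided expansion `λ(H²)` of the square of `H` (i.e. of the graph whose
random walk matrix is the square of that of `H`). -/
def lamHsq (H : SimpleGraph (Finset (Fin n))) (ℓ k : ℕ) : ℝ :=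
  twoSided (unifSubsets n ℓ) (matMul (walkMat H k) (walkMat H k))

/-- `Pr_{ω∼π}[ω_{typ a} = a ∧ ω_{typ b} = b]`. -/
def jointMass (K : WComplex (Fin n × U) n) (a b : Finset (Fin n × U)) : ℝ :=
  ∑ ω : Finset (Fin n × U),
    if restrict ω (typ a) = a ∧ restrict ω (typ b) = b then K.pi ω else 0

/-- The expanderized up-down walk with type-transition matrix `W`; taking
`W = walkMat H k` gives `UpDown(X, π, H)`, and taking `W = (walkMat H k)²`
gives `UpDown(X, π, H²)`.  Its `(ω̂, ω̃)` entry is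
`W(typ ω̂, typ ω̃) · Pr_{ω∼π}[ω_{typ ω̃} = ω̃ ∣ ω_{typ ω̂} = ω̂]`. -/
def expUpDown (K : WComplex (Fin n × U) n)
    (W : Finset (Fin n) → Finset (Fin n) → ℝ) :
    Finset (Fin n × U) → Finset (Fin n × U) → ℝ :=
  fun a b => W (typ a) (typ b) * (jointMass K a b / jointMass K a a)

/-- The expanderized down-walk `Qdo` from `X^(n) × binom([n],ℓ)` to `X^(ℓ)`. -/
def Qdown (K : WComplex (Fin n × U) n) (H : SimpleGraph (Finset (Fin n))) (k : ℕ) :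
    Finset (Fin n × U) × Finset (Fin n) → Finset (Fin n × U) → ℝ :=
  fun p b => if H.Adj p.2 (typ b) ∧ b ⊆ p.1 then (k : ℝ)⁻¹ else 0

/-- The expanderized up-walk `Qup` from `X^(ℓ)` to `X^(n) × binom([n],ℓ)`
(the adjoint of `Qdown` with respect to `(π_n ⊗ Unif, π_ℓ)`). -/
def Qup (K : WComplex (Fin n × U) n) (H : SimpleGraph (Finset (Fin n))) (k : ℕ) :
    Finset (Fin n × U) → Finset (Fin n × U) × Finset (Fin n) → ℝ :=
  fun b p =>
    (if H.Adj p.2 (typ b) then (k : ℝ)⁻¹ else 0) *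
      ((if b ⊆ p.1 then K.pi p.1 else 0) / K.mass b)

/-- The expanderized down-up walk `Paqx = Qdo·Qup` on `X^(n) × binom([n],ℓ)`. -/
def expDownUp (K : WComplex (Fin n × U) n) (H : SimpleGraph (Finset (Fin n))) (k : ℕ) :
    Finset (Fin n × U) × Finset (Fin n) → Finset (Fin n × U) × Finset (Fin n) → ℝ :=
  matMul (Qdown K H k) (Qup K H k)

/-- The product distribution `π_n ⊗ Unif_{binom([n],ℓ)}`. -/
def prodDist (K : WComplex (Fin n × U) n) (ℓ : ℕ) :
    Finset (Fin n × U) × Finset (Fin n) → ℝ :=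
  fun p => K.pi p.1 * unifSubsets n ℓ p.2

end Partite

/-! ## List colorings -/

section Coloring

variable {n : ℕ} {Col : Type*} [Fintype Col] [DecidableEq Col]

/-- The degree of a vertex in a graph. -/
def degree' {W : Type*} [Fintype W] (G : SimpleGraph W) (v : W) : ℕ :=
  (Finset.univ.filter fun u => G.Adj v u).card

/-- A proper list coloring of `(G, L)`. -/
def IsProperColoring (G : SimpleGraph (Fin n)) (L : Fin n → Finset Col)
    (c : Fin n → Col) : Prop :=
  (∀ v, c v ∈ L v) ∧ ∀ u v, G.Adj u v → c u ≠ c v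

/-- The face `{(v, c v) : v}` associated to a coloring `c`. -/
def colorFace (c : Fin n → Col) : Finset (Fin n × Col) :=
  Finset.univ.image fun v => (v, c v)

/-- `Y` is the list-coloring complex of `(G, L)`: its faces are the subsets of proper
list colorings and its weight is the uniform distribution on proper list colorings. -/
def IsColoringComplex (G : SimpleGraph (Fin n)) (L : Fin n → Finset Col)
    (Y : WComplex (Fin n × Col) n) : Prop :=
  (∀ α : Finset (Fin n × Col),
      α ∈ Y.faces ↔ ∃ c : Fin n → Col, IsProperColoring G L c ∧ α ⊆ colorFace c) ∧
  (∀ ω : Finset (Fin n × Col),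
      Y.pi ω =
        ∑ c : Fin n → Col,
          if IsProperColoring G L c ∧ ω = colorFace c then
            ((Finset.univ.filter fun c' : Fin n → Col =>
                IsProperColoring G L c').card : ℝ)⁻¹
          else 0)

end Coloring

/-! ## Ising models -/

section Ising

variable {n : ℕ}

/-- `±1` value of a Boolean spin. -/
def signR (b : Bool) : ℝ := if b then 1 else -1

/-- The (unnormalized) Ising weight `exp(½⟨x,Jx⟩ + ⟨h,x⟩)`. -/
def isingWeight (J : Matrix (Fin n) (Fin n) ℝ) (h : Fin n → ℝ) (x : Fin n → Bool) : ℝ :=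
  Real.exp ((1 / 2) * (∑ i, ∑ j, J i j * (signR (x i) * signR (x j))) +
    ∑ i, h i * signR (x i))

/-- The face `{(i, x i) : i}` associated to a spin configuration `x`. -/
def spinFace (x : Fin n → Bool) : Finset (Fin n × Bool) :=
  Finset.univ.image fun i => (i, x i)

/-- `Y` is the Ising complex of `(J, h)`. -/
def IsIsingComplex (J : Matrix (Fin n) (Fin n) ℝ) (h : Fin n → ℝ)
    (Y : WComplex (Fin n × Bool) n) : Prop :=
  (∀ α : Finset (Fin n × Bool), α ∈ Y.faces ↔ ∃ x : Fin n → Bool, α ⊆ spinFace x) ∧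
  (∀ ω : Finset (Fin n × Bool),
      Y.pi ω =
        (∑ x : Fin n → Bool, if ω = spinFace x then isingWeight J h x else 0) /
          ∑ x : Fin n → Bool, isingWeight J h x)

/-- The `ℓ₂ → ℓ₂` operator norm of a square matrix. -/
def matOpNorm {m : ℕ} (J : Matrix (Fin m) (Fin m) ℝ) : ℝ :=
  sSup {r | ∃ v : Fin m → ℝ, (∑ i, v i ^ 2) = 1 ∧
      r = Real.sqrt (∑ i, (J.mulVec v i) ^ 2)}

/-- The `2×2` principal submatrix of `J` at rows/columns `i, j`. -/
def principal2 (J : Matrix (Fin n) (Fin n) ℝ) (i j : Fin n) : Matrix (Fin 2) (Fin 2) ℝ :=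
  !![J i i, J i j; J j i, J j j]

/-- `‖h‖_∞`. -/
def normInf (h : Fin n → ℝ) : ℝ := sSup (Set.range fun i => |h i|)

/-- `‖h‖_₁`. -/
def norm1 (h : Fin n → ℝ) : ℝ := ∑ i, |h i|

end Ising

end Expanderized

namespace Expanderized
namespace WComplex

variable {V : Type*} [Fintype V] [DecidableEq V] {n : ℕ}

/-- The minimal probability `π*_{ω̂,k} = min_{ω̃ ∈ X_ω̂^(k)} π^(ω̂)_k(ω̃)`. -/
noncomputable def piStar (K : WComplex V n) (z : Finset V) (k : ℕ) : ℝ :=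
  sInf {r | ∃ α : Finset V, Disjoint α z ∧ z ∪ α ∈ K.faces ∧ α.card = k ∧
      r = K.linkLevel z k α}

/-- The constant `C_{ω̂,k}`: it is `1` if `π*_{ω̂,k} > 1/2` and
`(1 − 2π*_{ω̂,k})/log(1/π*_{ω̂,k} − 1)` otherwise. -/
noncomputable def Cconst (K : WComplex V n) (z : Finset V) (k : ℕ) : ℝ :=
  if 1 / 2 < piStar K z k then 1
  else (1 - 2 * piStar K z k) / Real.log (1 / piStar K z k - 1)

end WComplex
end Expanderized

namespace Expanderized

open Real

lemma mul_sinh_le_mul_sinh {x y : ℝ} (hy : 0 ≤ y) (hyx : y ≤ x) :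
    x * sinh y ≤ y * sinh x := by
  have hconv : ConvexOn ℝ (Set.Ici 0) sinh := by
    refine MonotoneOn.convexOn_of_deriv (convex_Ici 0) continuous_sinh.continuousOn
      differentiable_sinh.differentiableOn ?_
    rw [Real.deriv_sinh]
    intro a ha b hb hab
    rw [interior_Ici, Set.mem_Ioi] at ha hb
    exact Real.cosh_le_cosh.2 (by rwa [abs_of_pos ha, abs_of_pos hb])
  rcases hy.eq_or_lt with rfl | hy0
  · simp
  have hx : 0 < x := hy0.trans_le hyx
  have h1 : 0 ≤ 1 - y / x := by rw [sub_nonneg, div_le_one hx]; exact hyx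
  have := hconv.2 (Set.mem_Ici.2 le_rfl) (Set.mem_Ici.2 hx.le) h1
    (by positivity : 0 ≤ y / x) (by ring)
  simp only [smul_eq_mul, mul_zero, zero_add, sinh_zero, div_mul_cancel₀ _ hx.ne'] at this
  calc x * sinh y ≤ x * (y / x * sinh x) := by gcongr
    _ = y * sinh x := by field_simp

lemma hasDerivAt_hyp (k c y : ℝ) :
    HasDerivAt (fun y => c - k / cosh y - y * (sinh y / cosh y) + log (cosh y))
      ((k * sinh y - y) / cosh y ^ 2) y := by
  have hc := (cosh_pos y).ne'
  have h1 := ((hasDerivAt_const y k).div (hasDerivAt_cosh y) hc)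
  have h2 := (hasDerivAt_id y).mul ((hasDerivAt_sinh y).div (hasDerivAt_cosh y) hc)
  have h3 := (hasDerivAt_cosh y).log hc
  refine (((hasDerivAt_const y c).sub h1).sub h2).add h3 |>.congr_deriv ?_
  have := cosh_sq y
  simp only [id, Pi.div_apply]
  field_simp
  rw [this]; ring

lemma hyp_two_point_of_pos {x : ℝ} (hx : 0 < x) (y : ℝ) :
    (x + y) * sinh y - cosh y * (log (cosh y) - log (cosh x)) ≤
      x / sinh x * (cosh (x + y) - 1) := by
  have hs : 0 < sinh x := sinh_pos_iff.2 hx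
  set H : ℝ → ℝ := fun y => (x * cosh x / sinh x - log (cosh x)) - x / sinh x / cosh y
    - y * (sinh y / cosh y) + log (cosh y) with hH
  have hd : ∀ y, HasDerivAt H ((x / sinh x * sinh y - y) / cosh y ^ 2) y :=
    fun y => hasDerivAt_hyp _ _ y
  have hcont : Continuous H := continuous_iff_continuousAt.2 fun y => (hd y).continuousAt
  have hHx : H x = 0 := by
    simp only [hH]
    have := cosh_pos x
    field_simp
    linear_combination x * cosh_sq x
  have hnn : ∀ y, 0 ≤ y → 0 ≤ H y := by
    intro y hy
    rcases le_total y x with h | h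
    · have hanti : AntitoneOn H (Set.Icc 0 x) := by
        refine antitoneOn_of_deriv_nonpos (convex_Icc 0 x) hcont.continuousOn
          (fun z _ => (hd z).differentiableAt.differentiableWithinAt) ?_
        intro z hz
        rw [interior_Icc] at hz
        rw [(hd z).deriv]
        refine div_nonpos_of_nonpos_of_nonneg ?_ (sq_nonneg _)
        rw [sub_nonpos, div_mul_eq_mul_div, div_le_iff₀ hs]
        exact mul_sinh_le_mul_sinh hz.1.le hz.2.le
      exact hHx ▸ hanti ⟨hy, h⟩ ⟨hx.le, le_rfl⟩ h
    · have hmono : MonotoneOn H (Set.Ici x) := by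
        refine monotoneOn_of_deriv_nonneg (convex_Ici x) hcont.continuousOn
          (fun z _ => (hd z).differentiableAt.differentiableWithinAt) ?_
        intro z hz
        rw [interior_Ici, Set.mem_Ioi] at hz
        rw [(hd z).deriv]
        refine div_nonneg ?_ (sq_nonneg _)
        rw [sub_nonneg, div_mul_eq_mul_div, le_div_iff₀ hs, mul_comm]
        have := mul_sinh_le_mul_sinh hx.le hz.le
        linarith
      exact hHx ▸ hmono (Set.mem_Ici.2 le_rfl) h h
  have hy : 0 ≤ H y := by
    rcases le_total 0 y with h | h
    · exact hnn y h
    · have := hnn (-y) (by linarith)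
      simpa [hH, neg_div] using this
  have hc := cosh_pos y
  have key : x / sinh x * (cosh (x + y) - 1) -
      ((x + y) * sinh y - cosh y * (log (cosh y) - log (cosh x))) = cosh y * H y := by
    simp only [hH, cosh_add]
    field_simp
    ring
  have := mul_nonneg hc.le hy
  linarith

lemma hyp_two_point_of_nonpos {x y : ℝ} (hx : x ≤ 0) (hy : -x ≤ y) :
    (x + y) * sinh y - cosh y * (log (cosh y) - log (cosh x)) ≤
      (cosh (x + y) - 1) / cosh x := by
  have hcx := cosh_pos x
  set H : ℝ → ℝ := fun y => (1 - log (cosh x)) - (1 / cosh x) / cosh y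
    - y * (sinh y / cosh y) + log (cosh y) + (sinh x / cosh x - x) * (sinh y / cosh y) with hH
  have hd : ∀ y, HasDerivAt H
      (((1 / cosh x) * sinh y - y) / cosh y ^ 2 + (sinh x / cosh x - x) * (1 / cosh y ^ 2)) y := by
    intro y
    have hc := (cosh_pos y).ne'
    have h2 := ((hasDerivAt_sinh y).div (hasDerivAt_cosh y) hc).const_mul (sinh x / cosh x - x)
    refine ((hasDerivAt_hyp (1 / cosh x) (1 - log (cosh x)) y).add h2).congr_deriv ?_
    have := cosh_sq y
    field_simp
    rw [this]; ring
  have hcont : Continuous H := continuous_iff_continuousAt.2 fun y => (hd y).continuousAt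
  have hHx : H (-x) = 0 := by
    simp only [hH, cosh_neg, sinh_neg]
    field_simp
    rw [cosh_sq]; ring
  have hmono : MonotoneOn H (Set.Ici (-x)) := by
    refine monotoneOn_of_deriv_nonneg (convex_Ici _) hcont.continuousOn
      (fun z _ => (hd z).differentiableAt.differentiableWithinAt) ?_
    intro z hz
    rw [interior_Ici, Set.mem_Ioi] at hz
    rw [(hd z).deriv]
    have hslope : MonotoneOn (fun t => sinh t - cosh x * t) (Set.Ici (-x)) := by
      refine monotoneOn_of_deriv_nonneg (convex_Ici _) (by fun_prop) (by fun_prop) ?_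
      intro t ht
      rw [interior_Ici, Set.mem_Ioi] at ht
      have : HasDerivAt (fun t => sinh t - cosh x * t) (cosh t - cosh x * 1) t :=
        (hasDerivAt_sinh t).sub ((hasDerivAt_id t).const_mul _)
      rw [this.deriv, mul_one, sub_nonneg, cosh_le_cosh, abs_of_nonpos hx]
      exact ht.le.trans (le_abs_self t)
    have := hslope (Set.mem_Ici.2 le_rfl) (Set.mem_Ici.2 hz.le) hz.le
    simp only [sinh_neg] at this
    have e : ((1 / cosh x) * sinh z - z) / cosh z ^ 2 + (sinh x / cosh x - x) * (1 / cosh z ^ 2)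
        = (sinh z - cosh x * z + sinh x - cosh x * x) / (cosh x * cosh z ^ 2) := by
      have := cosh_pos z
      field_simp
      ring
    rw [e]
    have := cosh_pos z
    refine div_nonneg (by linarith) (by positivity)
  have hnn : 0 ≤ H y := hHx ▸ hmono (Set.mem_Ici.2 le_rfl) hy hy
  have hc := cosh_pos y
  have key : (cosh (x + y) - 1) / cosh x -
      ((x + y) * sinh y - cosh y * (log (cosh y) - log (cosh x))) = cosh y * H y := by
    simp only [hH, cosh_add]
    field_simp
    ring
  have := mul_nonneg hc.le hnn
  linarith

/-- Entropy of the square of a function taking the values `u`, `v` with probabilities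
`θ`, `1 - θ`. -/
def twoPointEnt (θ u v : ℝ) : ℝ :=
  θ * nlog (u ^ 2) + (1 - θ) * nlog (v ^ 2) - nlog (θ * u ^ 2 + (1 - θ) * v ^ 2)

lemma exists_hyp_param {θ u v : ℝ} (h0 : 0 < θ) (h1 : θ < 1) (hu : 0 < u) (hv : 0 < v) :
    ∃ x y T : ℝ, x = (log (1 - θ) - log θ) / 2 ∧ x + y = log u - log v ∧ 0 < T ∧
      twoPointEnt θ u v =
        T / cosh x * ((x + y) * sinh y - cosh y * (log (cosh y) - log (cosh x))) ∧
      θ * (1 - θ) * (u - v) ^ 2 = T / (2 * cosh x ^ 2) * (cosh (x + y) - 1) ∧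
      1 - 2 * θ = sinh x / cosh x := by
  set x := (log (1 - θ) - log θ) / 2 with hx
  set d := log u - log v with hd
  set t := (log u + log v) / 2 with ht
  have h1' : 0 < 1 - θ := by linarith
  refine ⟨x, d - x, exp (2 * t), rfl, by ring, exp_pos _, ?_⟩
  have hc := cosh_pos x
  have hex := exp_pos x
  have hθ2 : 1 - θ = θ * exp x ^ 2 := by
    rw [← exp_nat_mul, hx, show ((2 : ℕ) : ℝ) * ((log (1 - θ) - log θ) / 2)
      = log (1 - θ) - log θ by push_cast; ring, exp_sub, exp_log h1', exp_log h0]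
    field_simp
  have hθ : θ = exp (-x) / (2 * cosh x) := by
    rw [cosh_eq, exp_neg]
    field_simp
    linear_combination -hθ2
  have hφ : 1 - θ = exp x / (2 * cosh x) := by
    rw [hθ2, hθ, exp_neg]
    field_simp
  have hlu : log u = t + d / 2 := by rw [ht, hd]; ring
  have hlv : log v = t - d / 2 := by rw [ht, hd]; ring
  have hu2 : u ^ 2 = exp (2 * t) * exp d := by
    rw [← exp_log hu, ← exp_nat_mul, hlu, ← exp_add]; congr 1; push_cast; ring
  have hv2 : v ^ 2 = exp (2 * t) * exp (-d) := by
    rw [← exp_log hv, ← exp_nat_mul, hlv, ← exp_add]; congr 1; push_cast; ring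
  have huv : u * v = exp (2 * t) := by
    rw [← exp_log hu, ← exp_log hv, hlu, hlv, ← exp_add]; congr 1; ring
  have e1 : exp (-x) * exp d = exp (d - x) := by rw [← exp_add]; congr 1; ring
  have e2 : exp x * exp (-d) = exp (-(d - x)) := by rw [← exp_add]; congr 1; ring
  have e3 : exp (-x) * exp x = 1 := by rw [← exp_add]; simp
  have a1 : θ * u ^ 2 = exp (2 * t) * exp (d - x) / (2 * cosh x) := by
    rw [hu2, hθ, ← e1]; ring
  have a2 : (1 - θ) * v ^ 2 = exp (2 * t) * exp (-(d - x)) / (2 * cosh x) := by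
    rw [hv2, hφ, ← e2]; ring
  have hsum : θ * u ^ 2 + (1 - θ) * v ^ 2 = exp (2 * t) * (cosh (d - x) / cosh x) := by
    rw [a1, a2, cosh_eq (d - x)]; field_simp
  have hcy := cosh_pos (d - x)
  refine ⟨?_, ?_, ?_⟩
  · have hl : log (θ * u ^ 2 + (1 - θ) * v ^ 2)
        = 2 * t + (log (cosh (d - x)) - log (cosh x)) := by
      rw [hsum, log_mul (exp_pos _).ne' (by positivity), log_exp, log_div hcy.ne' hc.ne']
    have hlu2 : log (u ^ 2) = 2 * t + d := by rw [log_pow, hlu]; push_cast; ring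
    have hlv2 : log (v ^ 2) = 2 * t - d := by rw [log_pow, hlv]; push_cast; ring
    simp only [twoPointEnt, nlog]
    rw [hl, hsum, hlu2, hlv2, ← mul_assoc, ← mul_assoc, a1, a2, sinh_eq, cosh_eq (d - x)]
    field_simp
    ring
  · have : (u - v) ^ 2 = exp (2 * t) * (2 * (cosh d - 1)) := by
      rw [show (u - v) ^ 2 = u ^ 2 + v ^ 2 - 2 * (u * v) by ring, hu2, hv2, huv, cosh_eq]; ring
    rw [this, hφ, hθ, show x + (d - x) = d by ring]
    field_simp
    linear_combination (cosh d - 1) * e3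
  · rw [show 1 - 2 * θ = (1 - θ) - θ by ring, hφ, hθ, sinh_eq]
    field_simp

lemma twoPointEnt_le_of_lt_half {θ u v : ℝ} (h0 : 0 < θ) (h1 : θ < 1 / 2) (hu : 0 < u)
    (hv : 0 < v) :
    twoPointEnt θ u v ≤
      (log (1 - θ) - log θ) / (1 - 2 * θ) * (θ * (1 - θ) * (u - v) ^ 2) := by
  obtain ⟨x, y, T, hx, -, hT, hE, hV, hs⟩ := exists_hyp_param h0 (by linarith) hu hv
  have hc := cosh_pos x
  have hx0 : 0 < x := by
    rw [hx]; have := log_lt_log h0 (show θ < 1 - θ by linarith); linarith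
  have hsx := sinh_pos_iff.2 hx0
  rw [hE, hV, hs, show log (1 - θ) - log θ = 2 * x by rw [hx]; ring]
  calc _ ≤ T / cosh x * (x / sinh x * (cosh (x + y) - 1)) := by
        gcongr; exact hyp_two_point_of_pos hx0 y
    _ = _ := by field_simp

lemma twoPointEnt_le_of_half_le {θ u v : ℝ} (h0 : 1 / 2 ≤ θ) (h1 : θ < 1) (hv : 0 < v)
    (hvu : v ≤ u) : twoPointEnt θ u v ≤ 2 * (θ * (1 - θ) * (u - v) ^ 2) := by
  obtain ⟨x, y, T, hx, hxy, hT, hE, hV, -⟩ :=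
    exists_hyp_param (by linarith) h1 (hv.trans_le hvu) hv
  have hc := cosh_pos x
  have hx0 : x ≤ 0 := by
    rw [hx]; have := log_le_log (by linarith) (show 1 - θ ≤ θ by linarith); linarith
  have := log_le_log hv hvu
  rw [hE, hV]
  calc _ ≤ T / cosh x * ((cosh (x + y) - 1) / cosh x) := by
        gcongr; exact hyp_two_point_of_nonpos hx0 (by linarith)
    _ = _ := by field_simp

/-- The constant `log((1-p)/p) / (1-2p)` dominates `2`. -/
lemma two_le_logRatio {p : ℝ} (h0 : 0 < p) (h1 : p < 1 / 2) :
    2 ≤ (log (1 - p) - log p) / (1 - 2 * p) := by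
  have hs : |1 - 2 * p| < 1 := by rw [abs_lt]; constructor <;> linarith
  have h := hasSum_log_sub_log_of_abs_lt_one hs
  have hle := h.summable.sum_le_tsum {0} (fun k _ => by
    have : 0 ≤ 1 - 2 * p := by linarith
    positivity)
  rw [h.tsum_eq, show 1 + (1 - 2 * p) = 2 * (1 - p) by ring,
    show 1 - (1 - 2 * p) = 2 * p by ring, log_mul (by norm_num) (by linarith),
    log_mul (by norm_num) h0.ne'] at hle
  rw [le_div_iff₀ (by linarith)]
  norm_num at hle
  linarith

lemma logRatio_anti {p θ : ℝ} (h0 : 0 < p) (hp : p ≤ θ) (h1 : θ < 1 / 2) :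
    (log (1 - θ) - log θ) / (1 - 2 * θ) ≤ (log (1 - p) - log p) / (1 - 2 * p) := by
  have key : ∀ q : ℝ, 0 < q → q < 1 / 2 →
      HasSum (fun k : ℕ => 2 * (1 / (2 * (k : ℝ) + 1)) * (1 - 2 * q) ^ (2 * k))
        ((log (1 - q) - log q) / (1 - 2 * q)) := by
    intro q hq0 hq1
    have hs : |1 - 2 * q| < 1 := by rw [abs_lt]; constructor <;> linarith
    have h := (hasSum_log_sub_log_of_abs_lt_one hs).div_const (1 - 2 * q)
    rw [show 1 + (1 - 2 * q) = 2 * (1 - q) by ring,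
      show 1 - (1 - 2 * q) = 2 * q by ring, log_mul (by norm_num) (by linarith),
      log_mul (by norm_num) hq0.ne', add_sub_add_left_eq_sub] at h
    have e : (fun k : ℕ => 2 * (1 / (2 * (k : ℝ) + 1)) * (1 - 2 * q) ^ (2 * k)) =
        fun k : ℕ => 2 * (1 / (2 * (k : ℝ) + 1)) * (1 - 2 * q) ^ (2 * k + 1) / (1 - 2 * q) := by
      funext k
      have : 1 - 2 * q ≠ 0 := by linarith
      rw [pow_succ]
      field_simp
    rw [e]
    exact h
  refine hasSum_le (fun k => ?_) (key θ (h0.trans_le hp) h1) (key p h0 (by linarith))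
  gcongr
  linarith

lemma twoPointEnt_le {p θ u v : ℝ} (hp0 : 0 < p) (hp1 : p < 1 / 2) (hpθ : p ≤ θ) (hθ : θ ≤ 1)
    (hv : 0 ≤ v) (hvu : v ≤ u) :
    twoPointEnt θ u v ≤
      (log (1 - p) - log p) / (1 - 2 * p) * (θ * (1 - θ) * (u - v) ^ 2) := by
  have hpos : ∀ w, 0 < w → w ≤ u → twoPointEnt θ u w ≤
      (log (1 - p) - log p) / (1 - 2 * p) * (θ * (1 - θ) * (u - w) ^ 2) := by
    intro w hw hwu
    have hnn : 0 ≤ θ * (1 - θ) * (u - w) ^ 2 := by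
      have : 0 ≤ 1 - θ := by linarith
      have : 0 ≤ θ := by linarith
      positivity
    rcases hθ.eq_or_lt with rfl | hθ1
    · simp [twoPointEnt]
    rcases lt_or_ge θ (1 / 2) with h | h
    · exact (twoPointEnt_le_of_lt_half (by linarith) h (by linarith) hw).trans
        (mul_le_mul_of_nonneg_right (logRatio_anti hp0 hpθ h) hnn)
    · exact (twoPointEnt_le_of_half_le h hθ1 hw hwu).trans
        (mul_le_mul_of_nonneg_right (two_le_logRatio hp0 hp1) hnn)
  rcases hvu.eq_or_lt with rfl | hlt
  · have : θ * v ^ 2 + (1 - θ) * v ^ 2 = v ^ 2 := by ring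
    simp only [twoPointEnt, this, sub_self]
    apply le_of_eq; ring
  have hn : Continuous nlog := continuous_mul_log
  have hl : Continuous fun w => twoPointEnt θ u w := by unfold twoPointEnt; fun_prop
  have hmem : v ∈ closure (Set.Ioo v u) := by
    rw [closure_Ioo hlt.ne]; exact ⟨le_rfl, hlt.le⟩
  exact closure_minimal (s := Set.Ioo v u) (t := {w | twoPointEnt θ u w ≤
      (log (1 - p) - log p) / (1 - 2 * p) * (θ * (1 - θ) * (u - w) ^ 2)})
    (fun w hw => hpos w (hv.trans_lt hw.1) hw.2.le) (isClosed_le hl (by fun_prop)) hmem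

lemma two_mul_sq_mul_log_sub_monotone :
    MonotoneOn (fun r : ℝ => 2 * r * (r * log r) - 2 * (r - 1) - 3 * (r - 1) ^ 2)
      (Set.Ici 0) := by
  have hcont : Continuous fun r : ℝ => r * log r := continuous_mul_log
  have hd : ∀ r : ℝ, 0 < r → HasDerivAt
      (fun r : ℝ => 2 * r * (r * log r) - 2 * (r - 1) - 3 * (r - 1) ^ 2)
      (4 * (r * log r - r + 1)) r := by
    intro r hr
    have h1 := ((hasDerivAt_id r).const_mul 2).mul
      ((hasDerivAt_id r).mul (hasDerivAt_log hr.ne'))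
    have h2 := (((hasDerivAt_id r).sub_const 1).const_mul 2)
    have h3 := ((((hasDerivAt_id r).sub_const 1).pow 2).const_mul 3)
    refine ((h1.sub h2).sub h3).congr_deriv ?_
    simp [hr.ne']
    ring
  refine monotoneOn_of_deriv_nonneg (convex_Ici 0) (by fun_prop) ?_ ?_
  · intro r hr
    rw [interior_Ici, Set.mem_Ioi] at hr
    exact (hd r hr).differentiableAt.differentiableWithinAt
  · intro r hr
    rw [interior_Ici, Set.mem_Ioi] at hr
    rw [(hd r hr).deriv]
    have := mul_le_mul_of_nonneg_left (one_sub_inv_le_log_of_pos hr) hr.le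
    rw [mul_sub, mul_inv_cancel₀ hr.ne'] at this
    linarith

lemma two_mul_sq_mul_log_div_monotone :
    MonotoneOn (fun r : ℝ => (2 * r * (r * log r) - 2 * (r - 1)) / (r - 1) ^ 2)
      (Set.Ioi 1) := by
  have hd : ∀ r : ℝ, 1 < r → HasDerivAt
      (fun r : ℝ => (2 * r * (r * log r) - 2 * (r - 1)) / (r - 1) ^ 2)
      (2 * (r ^ 2 - 1 - 2 * r * log r) / (r - 1) ^ 3) r := by
    intro r hr
    have hr0 : r ≠ 0 := by positivity
    have hr1 : r - 1 ≠ 0 := by linarith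
    have h1 := ((hasDerivAt_id r).const_mul 2).mul
      ((hasDerivAt_id r).mul (hasDerivAt_log hr0))
    have h2 := (((hasDerivAt_id r).sub_const 1).const_mul 2)
    have h3 := (((hasDerivAt_id r).sub_const 1).pow 2)
    refine ((h1.sub h2).div h3 (pow_ne_zero 2 hr1)).congr_deriv ?_
    simp
    field_simp
    ring
  refine monotoneOn_of_deriv_nonneg (convex_Ioi 1)
    (fun r hr => (hd r hr).continuousAt.continuousWithinAt) ?_ ?_
  · intro r hr
    rw [interior_Ioi, Set.mem_Ioi] at hr
    exact (hd r hr).differentiableAt.differentiableWithinAt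
  · intro r hr
    rw [interior_Ioi, Set.mem_Ioi] at hr
    rw [(hd r hr).deriv]
    have hr0 : 0 < r := by linarith
    have h := self_le_sinh_iff.2 (log_nonneg hr.le)
    rw [sinh_eq, exp_neg, exp_log hr0] at h
    have h' := mul_le_mul_of_nonneg_left h hr0.le
    rw [mul_div_assoc', mul_sub, mul_inv_cancel₀ hr0.ne'] at h'
    have : 0 < r - 1 := by linarith
    refine div_nonneg ?_ (by positivity)
    nlinarith

/-- On `[0, M]`, the function `x ↦ x² log x²` lies below the quadratic polynomial touching it
doubly at `v` and simply at `M`. -/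
lemma exists_quadratic_majorant {v M : ℝ} (hv : 0 ≤ v) (hvM : v < M) :
    ∃ b c : ℝ, nlog (v ^ 2) + b * (M - v) + c * (M - v) ^ 2 = nlog (M ^ 2) ∧
      ∀ x, 0 ≤ x → x ≤ M → nlog (x ^ 2) ≤ nlog (v ^ 2) + b * (x - v) + c * (x - v) ^ 2 := by
  rcases hv.eq_or_lt with rfl | hv0
  · refine ⟨0, log (M ^ 2), by simp [nlog]; ring, fun x hx hxM => ?_⟩
    rcases hx.eq_or_lt with rfl | hx0
    · simp [nlog]
    · have : log (x ^ 2) ≤ log (M ^ 2) := log_le_log (by positivity) (by gcongr)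
      have := mul_le_mul_of_nonneg_left this (sq_nonneg x)
      simp [nlog] at this ⊢
      linarith
  set m := M / v with hm
  have hm1 : 1 < m := (one_lt_div hv0).2 hvM
  set N : ℝ → ℝ := fun r => 2 * r * (r * log r) - 2 * (r - 1) with hN
  have hMv : M = v * m := by rw [hm]; field_simp
  have hexp : ∀ r, 0 ≤ r → nlog ((v * r) ^ 2) =
      nlog (v ^ 2) + (4 * v * log v + 2 * v) * (v * r - v) +
        v ^ 2 * (2 * log v * (r - 1) ^ 2 + N r) := by
    intro r hr
    rcases hr.eq_or_lt with rfl | hr0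
    · simp [nlog, hN]; ring
    · simp only [nlog, hN, log_pow, log_mul hv0.ne' hr0.ne']; push_cast; ring
  have hm0 : m - 1 ≠ 0 := by linarith
  refine ⟨4 * v * log v + 2 * v, 2 * log v + N m / (m - 1) ^ 2, ?_, fun x hx hxM => ?_⟩
  · rw [hMv, hexp m (by linarith), show v * m - v = v * (m - 1) by ring]
    field_simp
  · set r := x / v with hr
    have hxv : x = v * r := by rw [hr]; field_simp
    have hr0 : 0 ≤ r := by positivity
    have hrm : r ≤ m := by rw [hr, hm]; gcongr
    have key : N r ≤ N m / (m - 1) ^ 2 * (r - 1) ^ 2 := by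
      rcases le_or_gt r 1 with h | h
      · have a1 := two_mul_sq_mul_log_sub_monotone hr0 (Set.mem_Ici.2 zero_le_one) h
        have a2 := two_mul_sq_mul_log_sub_monotone (Set.mem_Ici.2 zero_le_one)
          (Set.mem_Ici.2 (by linarith)) hm1.le
        simp only [log_one] at a1 a2
        have a3 : 3 ≤ N m / (m - 1) ^ 2 := by
          rw [le_div_iff₀ (by positivity)]; simp only [hN]; linarith
        have := mul_le_mul_of_nonneg_right a3 (sq_nonneg (r - 1))
        simp only [hN] at this ⊢
        linarith
      · have := two_mul_sq_mul_log_div_monotone h hm1 hrm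
        have hr1 : 0 < r - 1 := by linarith
        rw [← div_le_iff₀ (by positivity)]
        exact this
    rw [hxv, hexp r hr0, show v * r - v = v * (r - 1) by ring]
    have := mul_le_mul_of_nonneg_left key (sq_nonneg v)
    linarith

section Discrete

variable {ι : Type*} [Fintype ι]

/-- Variance of `f` with respect to the weight `μ`. -/
def vari (μ f : ι → ℝ) : ℝ := ∑ i, μ i * f i ^ 2 - (∑ i, μ i * f i) ^ 2

lemma vari_eq {μ f : ι → ℝ} (hμ : IsProbDist μ) :
    vari μ f = ∑ i, μ i * (f i - ∑ j, μ j * f j) ^ 2 := by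
  have : ∀ i, μ i * (f i - ∑ j, μ j * f j) ^ 2 =
      μ i * f i ^ 2 - 2 * (∑ j, μ j * f j) * (μ i * f i) + (∑ j, μ j * f j) ^ 2 * μ i := by
    intro i; ring
  simp only [this, Finset.sum_add_distrib, Finset.sum_sub_distrib, ← Finset.mul_sum, hμ.2, vari]
  ring

lemma vari_nonneg {μ f : ι → ℝ} (hμ : IsProbDist μ) : 0 ≤ vari μ f := by
  rw [vari_eq hμ]
  exact Finset.sum_nonneg fun i _ => mul_nonneg (hμ.1 i) (sq_nonneg _)

lemma ent_eq_zero_of_const {μ f : ι → ℝ} (hμ : IsProbDist μ) (c : ℝ)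
    (hf : ∀ i, μ i ≠ 0 → f i = c) : ent μ f = 0 := by
  have h : ∀ g : ℝ → ℝ, ∑ i, μ i * g (f i) = g c := by
    intro g
    rw [← one_mul (g c), ← hμ.2, Finset.sum_mul]
    refine Finset.sum_congr rfl fun i _ => ?_
    by_cases h : μ i = 0
    · simp [h]
    · rw [hf i h]
  have h1 := h nlog
  have h2 := h id
  simp only [id] at h2
  simp only [ent, phiEnt, Expanderized.expect, h1, h2, sub_self]

lemma ent_nonneg {μ f : ι → ℝ} (hμ : IsProbDist μ) (hf : ∀ i, 0 ≤ f i) : 0 ≤ ent μ f := by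
  have := convexOn_mul_log.map_sum_le (t := Finset.univ) (w := μ) (p := f)
    (fun i _ => hμ.1 i) hμ.2 (fun i _ => hf i)
  simp only [smul_eq_mul] at this
  simp only [ent, phiEnt, Expanderized.expect, nlog]
  linarith

/-- Logarithmic Sobolev inequality for the complete graph. -/
lemma ent_sq_le_vari {μ f : ι → ℝ} {p : ℝ} (hμ : IsProbDist μ) (hp0 : 0 < p) (hp1 : p < 1 / 2)
    (hp : ∀ i, μ i ≠ 0 → p ≤ μ i) (hf : ∀ i, 0 ≤ f i) :
    ent μ (fun i => f i ^ 2) ≤ (log (1 - p) - log p) / (1 - 2 * p) * vari μ f := by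
  have hK := two_le_logRatio hp0 hp1
  set κ := (log (1 - p) - log p) / (1 - 2 * p)
  obtain ⟨i₁, hi₁⟩ : ∃ i, μ i ≠ 0 := by
    by_contra! h
    have := hμ.2
    simp [h] at this
  obtain ⟨i₀, hi₀, hmax⟩ := (Finset.univ.filter fun i => μ i ≠ 0).exists_max_image f
    ⟨i₁, by simpa using hi₁⟩
  simp only [Finset.mem_filter, Finset.mem_univ, true_and] at hi₀ hmax
  set M := f i₀
  set m₁ := ∑ i, μ i * f i with hm₁
  set m₂ := ∑ i, μ i * f i ^ 2 with hm₂
  have hvar : 0 ≤ m₂ - m₁ ^ 2 := vari_nonneg (f := f) hμ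
  have hquad : ∀ a b c : ℝ, ∑ i, μ i * (a + b * f i + c * f i ^ 2) = a + b * m₁ + c * m₂ := by
    intro a b c
    have : ∀ i, μ i * (a + b * f i + c * f i ^ 2) =
      a * μ i + b * (μ i * f i) + c * (μ i * f i ^ 2) := fun i => by ring
    simp only [this, Finset.sum_add_distrib, ← Finset.mul_sum, hμ.2, mul_one, hm₁, hm₂]
  have hmono : ∀ g h : ι → ℝ, (∀ i, μ i ≠ 0 → g i ≤ h i) →
      ∑ i, μ i * g i ≤ ∑ i, μ i * h i := by
    intro g h hgh
    refine Finset.sum_le_sum fun i _ => ?_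
    by_cases hi : μ i = 0
    · simp [hi]
    · exact mul_le_mul_of_nonneg_left (hgh i hi) (hμ.1 i)
  have hm₁M : m₁ ≤ M := by
    have := hmono f (fun i => M + 0 * f i + 0 * f i ^ 2) (fun i hi => by simpa using hmax i hi)
    rwa [hquad, zero_mul, zero_mul, add_zero, add_zero] at this
  have hm₁0 : 0 ≤ m₁ := Finset.sum_nonneg fun i _ => mul_nonneg (hμ.1 i) (hf i)
  rcases hm₁M.eq_or_lt with heq | hlt
  · have hz : ∑ i, μ i * (M - f i) = 0 := by
      simp only [mul_sub, Finset.sum_sub_distrib, ← Finset.sum_mul, hμ.2]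
      rw [← hm₁]; linarith
    have hz' := (Finset.sum_eq_zero_iff_of_nonneg (fun i _ => by
      by_cases hi : μ i = 0
      · simp [hi]
      · exact mul_nonneg (hμ.1 i) (sub_nonneg.2 (hmax i hi)))).1 hz
    rw [ent_eq_zero_of_const hμ (M ^ 2) (fun i hi => by
      have := (mul_eq_zero.1 (hz' i (Finset.mem_univ i))).resolve_left hi
      rw [show f i = M by linarith])]
    exact mul_nonneg (by linarith) hvar
  have hd : 0 < M - m₁ := by linarith
  set v := (M * m₁ - m₂) / (M - m₁) with hv
  have hv' : v * (M - m₁) = M * m₁ - m₂ := by rw [hv]; field_simp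
  have hv0 : 0 ≤ v := by
    refine div_nonneg ?_ hd.le
    have := hmono (fun i => f i ^ 2) (fun i => 0 + M * f i + 0 * f i ^ 2) (fun i hi => by
      have := mul_le_mul_of_nonneg_right (hmax i hi) (hf i)
      nlinarith)
    rw [hquad] at this
    linarith
  have hvm₁ : v ≤ m₁ := by rw [hv, div_le_iff₀ hd]; nlinarith
  have hvM : 0 < M - v := by linarith
  set θ := (m₁ - v) / (M - v) with hθ
  have hθ' : θ * (M - v) = m₁ - v := by rw [hθ]; field_simp
  have hθ2 : θ * (M - v) ^ 2 = m₂ - 2 * v * m₁ + v ^ 2 := by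
    linear_combination (M - v) * hθ' - hv'
  have hθ1 : θ ≤ 1 := by rw [hθ, div_le_one hvM]; linarith
  have hpθ : p ≤ θ := by
    have h1 : μ i₀ * (f i₀ - v) ^ 2 ≤ ∑ i, μ i * (f i - v) ^ 2 :=
      Finset.single_le_sum (f := fun i => μ i * (f i - v) ^ 2)
        (fun i _ => mul_nonneg (hμ.1 i) (sq_nonneg _)) (Finset.mem_univ i₀)
    have h2 : ∑ i, μ i * (f i - v) ^ 2 = θ * (M - v) ^ 2 := by
      rw [hθ2]
      have := hquad (v ^ 2) (-2 * v) 1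
      rw [show m₂ - 2 * v * m₁ + v ^ 2 = v ^ 2 + -2 * v * m₁ + 1 * m₂ by ring, ← this]
      exact Finset.sum_congr rfl fun i _ => by ring
    have h3 := mul_le_mul_of_nonneg_right (hp i₀ hi₀) (sq_nonneg (f i₀ - v))
    exact le_of_mul_le_mul_right (h3.trans (h1.trans h2.le)) (by positivity)
  obtain ⟨b, c, hM, hmaj⟩ := exists_quadratic_majorant hv0 (show v < M by linarith)
  have h1 : ∑ i, μ i * nlog (f i ^ 2) ≤ θ * nlog (M ^ 2) + (1 - θ) * nlog (v ^ 2) := by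
    have := hmono (fun i => nlog (f i ^ 2))
      (fun i => (nlog (v ^ 2) - b * v + c * v ^ 2) + (b - 2 * c * v) * f i + c * f i ^ 2)
      (fun i hi => (hmaj (f i) (hf i) (hmax i hi)).trans (le_of_eq (by ring)))
    rw [hquad] at this
    refine this.trans (le_of_eq ?_)
    rw [← hM]
    linear_combination (-b) * hθ' - c * hθ2
  have hm₂' : m₂ = θ * M ^ 2 + (1 - θ) * v ^ 2 := by
    linear_combination (-2 * v) * hθ' - hθ2
  have hV : vari μ f = θ * (1 - θ) * (M - v) ^ 2 := by
    have : m₁ = θ * M + (1 - θ) * v := by linear_combination (-1) * hθ'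
    change m₂ - m₁ ^ 2 = _
    rw [hm₂', this]; ring
  have h2 := twoPointEnt_le hp0 hp1 hpθ hθ1 hv0 (show v ≤ M by linarith)
  rw [hV]
  refine le_trans ?_ h2
  simp only [ent, phiEnt, Expanderized.expect, twoPointEnt, ← hm₂]
  rw [hm₂']
  linarith

end Discrete

/-- The constant `C` attached to a minimal probability `p`. -/
def localConst (p : ℝ) : ℝ :=
  if 1 / 2 < p then 1 else (1 - 2 * p) / Real.log (1 / p - 1)

lemma localConst_nonneg {p : ℝ} (hp : 0 ≤ p) : 0 ≤ localConst p := by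
  unfold localConst
  split_ifs with h
  · exact zero_le_one
  rcases hp.eq_or_lt with rfl | hp0
  · simp
  refine div_nonneg (by linarith) (log_nonneg ?_)
  rw [le_sub_iff_add_le, le_div_iff₀ hp0]
  linarith

lemma localConst_mul_ent_sq_le_vari {ι : Type*} [Fintype ι] {μ f : ι → ℝ} {p : ℝ}
    (hμ : IsProbDist μ) (hp0 : 0 ≤ p) (hp : ∀ i, μ i ≠ 0 → p ≤ μ i) (hf : ∀ i, 0 ≤ f i) :
    localConst p * ent μ (fun i => f i ^ 2) ≤ vari μ f := by
  unfold localConst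
  split_ifs with h
  · obtain ⟨i₀, hi₀⟩ : ∃ i, μ i ≠ 0 := by
      by_contra! h'
      have := hμ.2
      simp [h'] at this
    rw [ent_eq_zero_of_const hμ (f i₀ ^ 2), mul_zero]
    · exact vari_nonneg hμ
    intro i hi
    by_contra hne
    have hii : i ≠ i₀ := fun e => hne (by rw [e])
    have h1 : μ i + μ i₀ ≤ ∑ j, μ j := by
      rw [← Finset.sum_pair hii]
      exact Finset.sum_le_sum_of_subset_of_nonneg (Finset.subset_univ _) fun j _ _ => hμ.1 j
    have := hp i hi
    have := hp i₀ hi₀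
    rw [hμ.2] at h1
    linarith
  rcases hp0.eq_or_lt with rfl | hp0
  · simpa using vari_nonneg hμ
  rcases (not_lt.1 h).eq_or_lt with rfl | hp1
  · norm_num
    exact vari_nonneg hμ
  have hl : log (1 / p - 1) = log (1 - p) - log p := by
    rw [← log_div (by linarith) hp0.ne', sub_div, div_self hp0.ne']
  have hpos : 0 < log (1 - p) - log p := sub_pos.2 (log_lt_log hp0 (by linarith))
  have h12 : 0 < 1 - 2 * p := by linarith
  have := ent_sq_le_vari hμ hp0 hp1 hp hf
  rw [hl]
  calc _ ≤ (1 - 2 * p) / (log (1 - p) - log p) *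
        ((log (1 - p) - log p) / (1 - 2 * p) * vari μ f) := by gcongr
    _ = vari μ f := by field_simp

section Kernel

variable {α β : Type*} [Fintype α] [Fintype β]

/-- Chain rule for the entropy. -/
lemma ent_eq_add_sum_ent {μ₁ : α → ℝ} {μ₂ : β → ℝ} {P : α → β → ℝ}
    (hμ : ∀ b, ∑ a, μ₁ a * P a b = μ₂ b) (g : β → ℝ) :
    ent μ₂ g = ent μ₁ (mApp P g) + ∑ a, μ₁ a * ent (P a) g := by
  have h : ∀ F : β → ℝ, ∑ b, μ₂ b * F b = ∑ a, μ₁ a * ∑ b, P a b * F b := by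
    intro F
    simp only [← hμ, Finset.sum_mul, Finset.mul_sum]
    rw [Finset.sum_comm]
    simp only [mul_assoc]
  simp only [ent, phiEnt, Expanderized.expect, mApp, h, mul_sub, Finset.sum_sub_distrib]
  ring

lemma EC_nonneg (μ₁ : α → ℝ) (μ₂ : β → ℝ) (P : α → β → ℝ) : 0 ≤ EC μ₁ μ₂ P :=
  Real.sSup_nonneg fun _ h => h.1

lemma LS_nonneg (μ : α → ℝ) (P : α → α → ℝ) : 0 ≤ LS μ P :=
  Real.sSup_nonneg fun _ h => h.1

variable {μ₁ : α → ℝ} {μ₂ : β → ℝ} {P : α → β → ℝ}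

lemma sum_mul_ent_nonneg (h₁ : ∀ a, 0 ≤ μ₁ a) (hP : ∀ a, μ₁ a ≠ 0 → IsProbDist (P a))
    {g : β → ℝ} (hg : ∀ b, 0 ≤ g b) : 0 ≤ ∑ a, μ₁ a * ent (P a) g := by
  refine Finset.sum_nonneg fun a _ => ?_
  by_cases ha : μ₁ a = 0
  · simp [ha]
  · exact mul_nonneg (h₁ a) (ent_nonneg (hP a ha) hg)

lemma EC_mul_ent_le (h₁ : ∀ a, 0 ≤ μ₁ a) (hP : ∀ a, μ₁ a ≠ 0 → IsProbDist (P a))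
    (hμ : ∀ b, ∑ a, μ₁ a * P a b = μ₂ b) {g : β → ℝ} (hg : ∀ b, 0 ≤ g b) :
    EC μ₁ μ₂ P * ent μ₂ g ≤ ∑ a, μ₁ a * ent (P a) g := by
  have hnn := sum_mul_ent_nonneg h₁ hP hg
  rcases le_or_gt (ent μ₂ g) 0 with h | h
  · exact (mul_nonpos_of_nonneg_of_nonpos (EC_nonneg _ _ _) h).trans hnn
  rw [← le_div_iff₀ h]
  refine Real.sSup_le (fun C hC => ?_) (by positivity)
  rw [le_div_iff₀ h]
  have h2 : ent μ₁ (mApp P g) ≤ (1 - C) * ent μ₂ g := hC.2 g hg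
  have h3 := ent_eq_add_sum_ent hμ g
  linarith

lemma mul_EC_le_LS (h₁ : ∀ a, 0 ≤ μ₁ a) (hP : ∀ a, μ₁ a ≠ 0 → IsProbDist (P a))
    (hμ : ∀ b, ∑ a, μ₁ a * P a b = μ₂ b) {Q : β → β → ℝ} {c : ℝ}
    (hloc : ∀ f : β → ℝ, (∀ x, 0 ≤ f x) →
      c * ∑ a, μ₁ a * ent (P a) (fun x => f x ^ 2) ≤
        inner' μ₂ f (fun x => f x - mApp Q f x)) :
    c * EC μ₁ μ₂ P ≤ LS μ₂ Q := by
  rcases le_or_gt c 0 with hc | hc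
  · exact (mul_nonpos_of_nonpos_of_nonneg hc (EC_nonneg _ _ _)).trans (LS_nonneg _ _)
  by_cases hex : ∃ g : β → ℝ, (∀ b, 0 ≤ g b) ∧ 0 < ent μ₂ g
  · obtain ⟨g, hg, hpos⟩ := hex
    refine le_csSup ⟨inner' μ₂ (fun x => √(g x)) (fun x => √(g x) - mApp Q (fun x => √(g x)) x)
      / ent μ₂ g, fun C hC => ?_⟩ ⟨mul_nonneg hc.le (EC_nonneg _ _ _), fun f hf => ?_⟩
    · have := hC.2 (fun x => √(g x)) (fun x => Real.sqrt_nonneg _)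
      simp only [Real.sq_sqrt (hg _)] at this
      rwa [le_div_iff₀ hpos]
    · refine le_trans ?_ (hloc f hf)
      rw [mul_assoc]
      exact mul_le_mul_of_nonneg_left
        (EC_mul_ent_le h₁ hP hμ fun b => sq_nonneg (f b)) hc.le
  · push Not at hex
    have : EC μ₁ μ₂ P = 0 := by
      refine Real.sSup_of_not_bddAbove ?_
      rintro ⟨B, hB⟩
      have hmem : |B| + 1 ∈ {C | 0 ≤ C ∧ ∀ f : β → ℝ, (∀ y, 0 ≤ f y) →
          phiEnt nlog μ₁ (mApp P f) ≤ (1 - C) * phiEnt nlog μ₂ f} := by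
        refine ⟨by positivity, fun f hf => ?_⟩
        have h1 := hex f hf
        have h2 := ent_eq_add_sum_ent hμ f
        have h3 := sum_mul_ent_nonneg h₁ hP hf
        simp only [ent] at h1 h2 h3
        nlinarith [abs_nonneg B]
      have := hB hmem
      linarith [le_abs_self B]
    rw [this, mul_zero]
    exact LS_nonneg _ _

lemma sum_mul_vari (hμ : ∀ b, ∑ a, μ₁ a * P a b = μ₂ b) (f : β → ℝ) :
    ∑ a, μ₁ a * vari (P a) f = ∑ b, μ₂ b * f b ^ 2 - ∑ a, μ₁ a * (∑ b, P a b * f b) ^ 2 := by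
  simp only [vari, mul_sub, Finset.sum_sub_distrib, ← hμ, Finset.sum_mul, Finset.mul_sum]
  rw [Finset.sum_comm]
  simp only [mul_assoc]

/-- The averaged local variance is the Dirichlet form of the down-up walk. -/
lemma sum_mul_vari_eq_inner' {D : β → α → ℝ} (hμ : ∀ b, ∑ a, μ₁ a * P a b = μ₂ b)
    (hD : ∀ a b, μ₂ b * D b a = μ₁ a * P a b) (f : β → ℝ) :
    ∑ a, μ₁ a * vari (P a) f = inner' μ₂ f (fun x => f x - mApp (matMul D P) f x) := by
  rw [sum_mul_vari hμ]
  simp only [inner', mul_sub, Finset.sum_sub_distrib]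
  congr 1
  · exact Finset.sum_congr rfl fun b _ => by ring
  · have h1 : ∀ b, mApp (matMul D P) f b = ∑ a, D b a * ∑ c, P a c * f c := by
      intro b
      simp only [mApp, matMul, Finset.sum_mul, Finset.mul_sum]
      rw [Finset.sum_comm]
      simp only [mul_assoc]
    have h2 : ∀ b, μ₂ b * (f b * mApp (matMul D P) f b) =
        ∑ a, μ₁ a * (P a b * f b * ∑ c, P a c * f c) := by
      intro b
      rw [h1, Finset.mul_sum, Finset.mul_sum]
      refine Finset.sum_congr rfl fun a _ => ?_
      linear_combination (f b * ∑ c, P a c * f c) * hD a b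
    simp only [h2]
    rw [Finset.sum_comm]
    refine Finset.sum_congr rfl fun a _ => ?_
    rw [← Finset.mul_sum, ← Finset.sum_mul, sq]

end Kernel

namespace WComplex

section Walks

variable {V : Type*} [Fintype V] [DecidableEq V] {n : ℕ} (K : WComplex V n)

lemma pi_nonneg (ω : Finset V) : 0 ≤ K.pi ω := by
  by_cases h : ω ∈ K.faces
  · by_cases hc : ω.card = n
    · exact (K.pi_pos ω h hc).le
    · exact (K.pi_zero_of_card_ne ω hc).ge
  · exact (K.pi_zero_of_not_mem ω h).ge

lemma mass_nonneg (a : Finset V) : 0 ≤ K.mass a :=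
  Finset.sum_nonneg fun ω _ => by split_ifs <;> simp [K.pi_nonneg]

lemma mass_mono {a b : Finset V} (h : a ⊆ b) : K.mass b ≤ K.mass a := by
  refine Finset.sum_le_sum fun ω _ => ?_
  by_cases hb : b ⊆ ω
  · rw [if_pos hb, if_pos (h.trans hb)]
  · rw [if_neg hb]
    split_ifs <;> simp [K.pi_nonneg]

lemma mass_eq_zero_of_subset {a b : Finset V} (h : a ⊆ b) (ha : K.mass a = 0) :
    K.mass b = 0 :=
  le_antisymm (ha ▸ K.mass_mono h) (K.mass_nonneg b)

lemma mass_eq_pi {ω : Finset V} (h : ω.card = n) : K.mass ω = K.pi ω := by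
  unfold mass
  rw [Finset.sum_eq_single ω]
  · simp
  · intro b _ hb
    split_ifs with hs
    · refine K.pi_zero_of_card_ne b fun hc => hb ?_
      exact (Finset.eq_of_subset_of_card_le hs (by omega)).symm
    · rfl
  · simp

lemma mem_faces_of_mass_ne_zero {a : Finset V} (h : K.mass a ≠ 0) : a ∈ K.faces := by
  obtain ⟨ω, -, hω⟩ := Finset.exists_ne_zero_of_sum_ne_zero h
  split_ifs at hω with hs
  · exact K.down_closed ω (by_contra fun hn => hω (K.pi_zero_of_not_mem ω hn)) a hs
  · exact absurd rfl hω

lemma level_top : K.level n = K.pi := by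
  funext ω
  by_cases h : ω.card = n
  · simp [level, h, K.mass_eq_pi h]
  · simp [level, h, K.pi_zero_of_card_ne ω h]

lemma level_nonneg (k : ℕ) (a : Finset V) : 0 ≤ K.level k a := by
  unfold level
  have := K.mass_nonneg a
  split_ifs <;> positivity

lemma card_filter_between {a ω : Finset V} (h : a ⊆ ω) {k : ℕ} (hk : a.card ≤ k) :
    (Finset.univ.filter fun b : Finset V => b.card = k ∧ a ⊆ b ∧ b ⊆ ω).card =
      (ω.card - a.card).choose (k - a.card) := by
  rw [← Finset.card_sdiff_of_subset h, ← Finset.card_powersetCard]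
  refine Finset.card_nbij' (fun b => b \ a) (fun c => a ∪ c) ?_ ?_ ?_ ?_
  · intro b hb
    simp only [Finset.coe_filter, Finset.mem_univ, true_and, Set.mem_ofPred_eq] at hb
    simp only [Finset.mem_coe, Finset.mem_powersetCard]
    exact ⟨Finset.sdiff_subset_sdiff hb.2.2 subset_rfl,
      by rw [Finset.card_sdiff_of_subset hb.2.1, hb.1]⟩
  · intro c hc
    simp only [Finset.mem_coe, Finset.mem_powersetCard] at hc
    simp only [Finset.coe_filter, Finset.mem_univ, true_and, Set.mem_ofPred_eq]
    refine ⟨?_, Finset.subset_union_left,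
      Finset.union_subset h (hc.1.trans Finset.sdiff_subset)⟩
    rw [Finset.card_union_of_disjoint (Finset.disjoint_of_subset_right hc.1
      Finset.disjoint_sdiff), hc.2]
    omega
  · intro b hb
    simp only [Finset.coe_filter, Finset.mem_univ, true_and, Set.mem_ofPred_eq] at hb
    exact Finset.union_sdiff_of_subset hb.2.1
  · intro c hc
    simp only [Finset.mem_coe, Finset.mem_powersetCard] at hc
    exact Finset.union_sdiff_cancel_left
      (Finset.disjoint_of_subset_right hc.1 Finset.disjoint_sdiff)

lemma sum_mass_superset {a : Finset V} {k : ℕ} (hk : a.card ≤ k) :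
    ∑ b : Finset V, (if b.card = k ∧ a ⊆ b then K.mass b else 0) =
      ((n - a.card).choose (k - a.card) : ℝ) * K.mass a := by
  have h1 : ∀ b : Finset V, (if b.card = k ∧ a ⊆ b then K.mass b else 0) =
      ∑ ω : Finset V, if b.card = k ∧ a ⊆ b ∧ b ⊆ ω then K.pi ω else 0 := by
    intro b
    by_cases hb : b.card = k ∧ a ⊆ b
    · simp [hb, mass]
    · rw [if_neg hb]
      exact (Finset.sum_eq_zero fun ω _ => if_neg fun h => hb ⟨h.1, h.2.1⟩).symm
  simp only [h1]
  rw [Finset.sum_comm, mass, Finset.mul_sum]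
  refine Finset.sum_congr rfl fun ω _ => ?_
  rw [← Finset.sum_filter, Finset.sum_const, nsmul_eq_mul]
  by_cases hω : ω.card = n
  · by_cases ha : a ⊆ ω
    · rw [card_filter_between ha hk, hω, if_pos ha]
    · rw [if_neg ha, mul_zero, Finset.filter_false_of_mem fun b _ h => ha (h.2.1.trans h.2.2)]
      simp
  · simp [K.pi_zero_of_card_ne ω hω]

lemma isProbDist_up {a : Finset V} {k : ℕ} (hak : a.card ≤ k) (hk : k ≤ n)
    (ha : K.mass a ≠ 0) : IsProbDist (K.up a.card k a) := by
  refine ⟨fun b => ?_, ?_⟩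
  · have := K.mass_nonneg a
    have := K.mass_nonneg b
    unfold up
    split_ifs <;> positivity
  · have h : ∀ b, K.up a.card k a b = (((n - a.card).choose (k - a.card) : ℝ))⁻¹ / K.mass a *
        (if b.card = k ∧ a ⊆ b then K.mass b else 0) := by
      intro b
      unfold up
      by_cases hb : b.card = k ∧ a ⊆ b
      · rw [if_pos ⟨rfl, hb⟩, if_pos hb]; ring
      · rw [if_neg fun h => hb h.2, if_neg hb, mul_zero]
    simp only [h, ← Finset.mul_sum, K.sum_mass_superset hak]
    have : ((n - a.card).choose (k - a.card) : ℝ) ≠ 0 := by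
      have := Nat.choose_pos (n := n - a.card) (k := k - a.card) (by omega)
      positivity
    field_simp

lemma isProbDist_up_of_level_ne_zero {ℓ k : ℕ} (hℓ : ℓ ≤ k) (hk : k ≤ n) (a : Finset V)
    (ha : K.level ℓ a ≠ 0) : IsProbDist (K.up ℓ k a) := by
  unfold level at ha
  split_ifs at ha with hc
  · subst hc
    exact K.isProbDist_up hℓ hk fun h => ha (by simp [h])
  · exact absurd rfl ha

/-- Reversibility: the down-walk is the adjoint of the up-walk. -/
lemma level_mul_down {ℓ k : ℕ} (hℓ : ℓ ≤ k) (hk : k ≤ n) (a b : Finset V) :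
    K.level k b * K.down k ℓ b a = K.level ℓ a * K.up ℓ k a b := by
  unfold level down up
  by_cases h : a.card = ℓ ∧ b.card = k ∧ a ⊆ b
  · obtain ⟨ha, hb, hab⟩ := h
    rw [if_pos hb, if_pos ⟨hb, ha, hab⟩, if_pos ha, if_pos ⟨ha, hb, hab⟩]
    by_cases hm : K.mass a = 0
    · simp [hm, K.mass_eq_zero_of_subset hab hm]
    have hch := congrArg (Nat.cast (R := ℝ)) (Nat.choose_mul (n := n) hℓ)
    push_cast at hch
    have h1 : (n.choose k : ℝ) ≠ 0 := by exact_mod_cast (Nat.choose_pos hk).ne'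
    have h2 : (k.choose ℓ : ℝ) ≠ 0 := by exact_mod_cast (Nat.choose_pos hℓ).ne'
    have h3 : (n.choose ℓ : ℝ) ≠ 0 := by exact_mod_cast (Nat.choose_pos (hℓ.trans hk)).ne'
    have h4 : ((n - ℓ).choose (k - ℓ) : ℝ) ≠ 0 := by
      exact_mod_cast (Nat.choose_pos (by omega)).ne'
    field_simp
    linear_combination (-K.mass b) * hch
  · have h' : ¬(b.card = k ∧ a.card = ℓ ∧ a ⊆ b) := fun h' => h ⟨h'.2.1, h'.1, h'.2.2⟩
    rw [if_neg h, if_neg h']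
    simp

lemma sum_level_mul_up {ℓ k : ℕ} (hℓ : ℓ ≤ k) (hk : k ≤ n) (b : Finset V) :
    ∑ a, K.level ℓ a * K.up ℓ k a b = K.level k b := by
  simp only [← K.level_mul_down hℓ hk, ← Finset.mul_sum]
  by_cases hb : b.card = k
  · have : ∑ a, K.down k ℓ b a = 1 := by
      have e : (Finset.univ.filter fun a : Finset V => b.card = k ∧ a.card = ℓ ∧ a ⊆ b) =
          b.powersetCard ℓ := by
        ext a; simp [Finset.mem_powersetCard, hb, and_comm]
      unfold down
      rw [← Finset.sum_filter, e, Finset.sum_const, Finset.card_powersetCard, hb, nsmul_eq_mul]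
      have h2 : (k.choose ℓ : ℝ) ≠ 0 := by exact_mod_cast (Nat.choose_pos hℓ).ne'
      field_simp
    rw [this, mul_one]
  · simp [level, hb]

lemma linkPi_nonneg (z α : Finset V) : 0 ≤ K.linkPi z α := by
  unfold linkPi
  have := K.pi_nonneg (z ∪ α)
  have := K.mass_nonneg z
  split_ifs <;> positivity

lemma linkMass_nonneg (z α : Finset V) : 0 ≤ K.linkMass z α :=
  Finset.sum_nonneg fun β _ => by split_ifs <;> simp [K.linkPi_nonneg]

lemma linkLevel_nonneg (z : Finset V) (k : ℕ) (α : Finset V) : 0 ≤ K.linkLevel z k α := by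
  unfold linkLevel
  have := K.linkMass_nonneg z α
  split_ifs <;> positivity

lemma linkMass_eq {z α : Finset V} (h : Disjoint α z) :
    K.linkMass z α = K.mass (z ∪ α) / K.mass z := by
  unfold linkMass linkPi mass
  have e : ∀ β : Finset V, (if α ⊆ β then if Disjoint β z then K.pi (z ∪ β) /
      (∑ ω : Finset V, if z ⊆ ω then K.pi ω else 0) else 0 else 0) =
      if Disjoint β z ∧ α ⊆ β then K.pi (z ∪ β) /
        (∑ ω : Finset V, if z ⊆ ω then K.pi ω else 0) else 0 := by
    intro β
    by_cases h1 : α ⊆ β <;> by_cases h2 : Disjoint β z <;> simp [h1, h2]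
  simp only [e]
  rw [Finset.sum_div, ← Finset.sum_filter]
  simp only [ite_div, zero_div]
  rw [← Finset.sum_filter (fun ω : Finset V => z ∪ α ⊆ ω)]
  refine Finset.sum_nbij' (fun β => z ∪ β) (fun ω => ω \ z) ?_ ?_ ?_ ?_ ?_
  · intro β hβ
    simp only [Finset.mem_filter, Finset.mem_univ, true_and] at hβ ⊢
    exact Finset.union_subset_union subset_rfl hβ.2
  · intro ω hω
    simp only [Finset.mem_filter, Finset.mem_univ, true_and] at hω ⊢
    exact ⟨Finset.sdiff_disjoint,
      Finset.subset_sdiff.2 ⟨Finset.subset_union_right.trans hω, h⟩⟩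
  · intro β hβ
    simp only [Finset.mem_filter, Finset.mem_univ, true_and] at hβ
    exact Finset.union_sdiff_cancel_left hβ.1.symm
  · intro ω hω
    simp only [Finset.mem_filter, Finset.mem_univ, true_and] at hω
    exact Finset.union_sdiff_of_subset (Finset.subset_union_left.trans hω)
  · intro β _
    rfl

lemma piStar_nonneg (z : Finset V) (k : ℕ) : 0 ≤ K.piStar z k :=
  Real.sInf_nonneg (by rintro _ ⟨α, -, -, -, rfl⟩; exact K.linkLevel_nonneg z k α)

lemma piStar_le_up {z b : Finset V} {ℓ k : ℕ} (hz : z.card = ℓ)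
    (h : K.up ℓ k z b ≠ 0) : K.piStar z (k - ℓ) ≤ K.up ℓ k z b := by
  unfold up at h ⊢
  split_ifs at h ⊢ with hc
  · obtain ⟨-, hb, hzb⟩ := hc
    have hm : K.mass b ≠ 0 := fun h0 => h (by simp [h0])
    have hcard : (b \ z).card = k - ℓ := by rw [Finset.card_sdiff_of_subset hzb, hb, hz]
    refine csInf_le ⟨0, ?_⟩ ⟨b \ z, Finset.sdiff_disjoint, ?_, hcard, ?_⟩
    · rintro _ ⟨α, -, -, -, rfl⟩
      exact K.linkLevel_nonneg z _ α
    · rw [Finset.union_sdiff_of_subset hzb]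
      exact K.mem_faces_of_mass_ne_zero hm
    · rw [linkLevel, if_pos hcard, K.linkMass_eq Finset.sdiff_disjoint,
        Finset.union_sdiff_of_subset hzb, hz]
  · exact absurd rfl h

lemma sInf_Cconst_nonneg (ℓ k : ℕ) :
    0 ≤ sInf {r | ∃ z ∈ K.faces, z.card = ℓ ∧ r = Cconst K z k} :=
  Real.sInf_nonneg (by
    rintro _ ⟨z, -, -, rfl⟩; exact localConst_nonneg (K.piStar_nonneg z k))

lemma sInf_Cconst_mul_ent_le {ℓ k : ℕ} (hℓ : ℓ ≤ k) (hk : k ≤ n) {f : Finset V → ℝ}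
    (hf : ∀ x, 0 ≤ f x) :
    sInf {r | ∃ z ∈ K.faces, z.card = ℓ ∧ r = Cconst K z (k - ℓ)} *
        ∑ a, K.level ℓ a * ent (K.up ℓ k a) (fun x => f x ^ 2) ≤
      ∑ a, K.level ℓ a * vari (K.up ℓ k a) f := by
  rw [Finset.mul_sum]
  refine Finset.sum_le_sum fun z _ => ?_
  by_cases hz : K.level ℓ z = 0
  · simp [hz]
  have hP := K.isProbDist_up_of_level_ne_zero hℓ hk z hz
  have hzc : z.card = ℓ := by
    by_contra h
    exact hz (if_neg h)
  have hzm : K.mass z ≠ 0 := fun h => hz (by simp [level, h])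
  have hC : sInf {r | ∃ z ∈ K.faces, z.card = ℓ ∧ r = Cconst K z (k - ℓ)} ≤
      Cconst K z (k - ℓ) := by
    refine csInf_le ⟨0, ?_⟩ ⟨z, K.mem_faces_of_mass_ne_zero hzm, hzc, rfl⟩
    rintro _ ⟨w, -, -, rfl⟩
    exact localConst_nonneg (K.piStar_nonneg w _)
  have h1 : Cconst K z (k - ℓ) * ent (K.up ℓ k z) (fun x => f x ^ 2) ≤ vari (K.up ℓ k z) f :=
    localConst_mul_ent_sq_le_vari hP (K.piStar_nonneg z _)
      (fun b hb => K.piStar_le_up hzc hb) hf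
  have h2 := mul_le_mul_of_nonneg_right hC (ent_nonneg hP fun x => sq_nonneg (f x))
  have h3 := mul_le_mul_of_nonneg_left (h2.trans h1) (K.level_nonneg ℓ z)
  linarith

/-- Log-Sobolev inequality for the down-up walk. -/
lemma sInf_Cconst_mul_EC_le_LS_downUp {ℓ : ℕ} (hℓ : ℓ ≤ n) :
    sInf {r | ∃ z ∈ K.faces, z.card = ℓ ∧ r = Cconst K z (n - ℓ)} *
        EC (K.level ℓ) K.pi (K.up ℓ n) ≤ LS K.pi (K.downUp ℓ) := by
  rw [← K.level_top]
  refine mul_EC_le_LS (K.level_nonneg ℓ) (K.isProbDist_up_of_level_ne_zero hℓ le_rfl)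
    (K.sum_level_mul_up hℓ le_rfl) fun f hf => ?_
  refine (K.sInf_Cconst_mul_ent_le hℓ le_rfl hf).trans (le_of_eq ?_)
  exact sum_mul_vari_eq_inner' (K.sum_level_mul_up hℓ le_rfl)
    (K.level_mul_down hℓ le_rfl) f

end Walks

end WComplex

section Spectral

variable {α : Type*} [Fintype α]

lemma specGap_mul_vari_le {μ : α → ℝ} {A W : α → α → ℝ} (hμ : IsProbDist μ)
    (hW : ∀ x y, 0 ≤ W x y) (hsymm : ∀ x y, W x y = W y x) (hrow : ∀ x, ∑ y, W x y = μ x)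
    (hA : ∀ f, inner' μ f (fun _ => 1) = 0 →
      inner' μ f (mApp A f) = ∑ x, ∑ y, W x y * (f x * f y)) (g : α → ℝ) :
    specGap μ A * vari μ g ≤ ∑ x, μ x * g x ^ 2 - ∑ x, ∑ y, W x y * (g x * g y) := by
  have hrow' : ∀ u : α → ℝ, ∑ x, ∑ y, W x y * u x = ∑ x, μ x * u x := by
    intro u
    simp only [← Finset.sum_mul, hrow]
  have hcol' : ∀ u : α → ℝ, ∑ x, ∑ y, W x y * u y = ∑ x, μ x * u x := by
    intro u
    rw [Finset.sum_comm, ← hrow']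
    simp only [hsymm]
  have hq : ∀ f : α → ℝ, ∑ x, ∑ y, W x y * (f x * f y) ≤ ∑ x, μ x * f x ^ 2 := by
    intro f
    have h1 := hrow' fun x => f x ^ 2
    have h2 := hcol' fun x => f x ^ 2
    have h3 : ∑ x, ∑ y, W x y * (f x * f y) ≤
        ∑ x, ∑ y, (W x y * f x ^ 2 + W x y * f y ^ 2) / 2 := by
      gcongr with x _ y _
      nlinarith [mul_nonneg (hW x y) (sq_nonneg (f x - f y))]
    simp only [← Finset.sum_div, Finset.sum_add_distrib] at h3
    linarith
  set m := ∑ y, μ y * g y with hm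
  set h : α → ℝ := fun x => g x - m with hh
  have hmean : ∑ x, μ x * h x = 0 := by
    simp only [hh, mul_sub, Finset.sum_sub_distrib, ← Finset.sum_mul, hμ.2, ← hm]
    ring
  have hvar : ∑ x, μ x * h x ^ 2 = vari μ g := (vari_eq hμ).symm
  have hWh : ∑ x, ∑ y, W x y * (h x * h y) = ∑ x, ∑ y, W x y * (g x * g y) - m ^ 2 := by
    have h1 : ∀ x y, W x y * (h x * h y) =
        W x y * (g x * g y) - m * (W x y * g x) - m * (W x y * g y) + m ^ 2 * W x y := by
      intro x y
      simp only [hh]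
      ring
    simp only [h1, Finset.sum_sub_distrib, Finset.sum_add_distrib, ← Finset.mul_sum, hrow',
      hcol', hrow, hμ.2, ← hm]
    ring
  have hrhs : ∑ x, μ x * g x ^ 2 - ∑ x, ∑ y, W x y * (g x * g y) =
      ∑ x, μ x * h x ^ 2 - ∑ x, ∑ y, W x y * (h x * h y) := by
    rw [hWh, hvar, vari]
    ring
  rw [hrhs, ← hvar]
  have hs0 : 0 ≤ ∑ x, μ x * h x ^ 2 :=
    Finset.sum_nonneg fun x _ => mul_nonneg (hμ.1 x) (sq_nonneg _)
  set s := ∑ x, μ x * h x ^ 2 with hs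
  rcases hs0.eq_or_lt with h0 | hpos
  · have := hq h
    rw [← h0, mul_zero]
    linarith
  have hr : √s ≠ 0 := (Real.sqrt_pos.2 hpos).ne'
  have hrs : √s ^ 2 = s := Real.sq_sqrt hs0
  have hle : (∑ x, ∑ y, W x y * (h x * h y)) / s ≤ lambda2 μ A := by
    refine le_csSup ⟨1, ?_⟩ ⟨fun x => h x / √s, ?_, ?_, ?_⟩
    · rintro _ ⟨f, hf1, hf0, rfl⟩
      rw [hA f hf0, ← hf1]
      refine (hq f).trans (le_of_eq ?_)
      exact Finset.sum_congr rfl fun x _ => by rw [sq]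
    · have : ∀ x, μ x * (h x / √s * (h x / √s)) = μ x * h x ^ 2 / s := by
        intro x
        rw [div_mul_div_comm, ← sq, ← sq, hrs, mul_div_assoc]
      simp only [inner', this, ← Finset.sum_div, ← hs]
      exact div_self hpos.ne'
    · have : ∀ x, μ x * (h x / √s * 1) = μ x * h x / √s := fun x => by ring
      simp only [inner', this, ← Finset.sum_div, hmean, zero_div]
    · rw [hA]
      · simp only [Finset.sum_div]
        refine Finset.sum_congr rfl fun x _ => Finset.sum_congr rfl fun y _ => ?_
        rw [div_mul_div_comm, ← sq, hrs, mul_div_assoc]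
      · have : ∀ x, μ x * (h x / √s * 1) = μ x * h x / √s := fun x => by ring
        simp only [inner', this, ← Finset.sum_div, hmean, zero_div]
  rw [div_le_iff₀ hpos] at hle
  unfold specGap
  linarith

end Spectral

namespace WComplex

section UpDown

variable {V : Type*} [Fintype V] [DecidableEq V] {n : ℕ} (K : WComplex V n)

lemma sum_covering (z : Finset V) (G : Finset V → ℝ) :
    ∑ b : Finset V, (if b.card = z.card + 1 ∧ z ⊆ b then G b else 0) =
      ∑ x, if x ∈ z then 0 else G (insert x z) := by
  rw [← Finset.sum_filter, Finset.sum_congr rfl fun x _ =>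
    (ite_not (x ∈ z) (G (insert x z)) 0).symm, ← Finset.sum_filter]
  symm
  refine Finset.sum_nbij (fun x => insert x z) ?_ ?_ ?_ fun _ _ => rfl
  · intro x hx
    simp only [Finset.mem_filter, Finset.mem_univ, true_and] at hx ⊢
    exact ⟨Finset.card_insert_of_notMem hx, Finset.subset_insert x z⟩
  · intro x hx y hy hxy
    simp only [Finset.coe_filter, Finset.mem_univ, true_and, Set.mem_ofPred_eq] at hx hy
    have : x ∈ insert y z := (show insert x z = insert y z from hxy) ▸ Finset.mem_insert_self x z
    exact (Finset.mem_insert.1 this).resolve_right hx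
  · intro b hb
    simp only [Finset.coe_filter, Finset.mem_univ, true_and, Set.mem_ofPred_eq] at hb
    obtain ⟨x, hx⟩ := Finset.card_eq_one.1
      (show (b \ z).card = 1 by rw [Finset.card_sdiff_of_subset hb.2]; omega)
    have hxb : x ∈ b \ z := hx ▸ Finset.mem_singleton_self x
    refine ⟨x, by simpa using (Finset.mem_sdiff.1 hxb).2, ?_⟩
    show insert x z = b
    rw [Finset.insert_eq, ← hx, Finset.sdiff_union_of_subset hb.2]

lemma sum_insert_eq_sum_erase (F : Finset V → V → ℝ) :
    ∑ z : Finset V, ∑ x, (if x ∈ z then 0 else F (insert x z) x) =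
      ∑ b : Finset V, ∑ x, if x ∈ b then F b x else 0 := by
  rw [Finset.sum_comm, Finset.sum_comm (γ := Finset V) (α := V)]
  refine Finset.sum_congr rfl fun x _ => ?_
  rw [← Finset.sum_filter, Finset.sum_congr rfl fun z _ =>
    (ite_not (x ∈ z) (F (insert x z) x) 0).symm, ← Finset.sum_filter]
  refine Finset.sum_nbij' (fun z => insert x z) (fun b => b.erase x) ?_ ?_ ?_ ?_ fun _ _ => rfl
  · simp
  · simp
  · intro z hz
    exact Finset.erase_insert (by simpa using hz)
  · intro b hb
    exact Finset.insert_erase (by simpa using hb)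

lemma sum_covered {b : Finset V} {k : ℕ} (hb : b.card = k + 1) (G : Finset V → ℝ) :
    ∑ c : Finset V, (if c.card = k ∧ c ⊆ b then G c else 0) = ∑ x ∈ b, G (b.erase x) := by
  rw [← Finset.sum_filter]
  symm
  refine Finset.sum_nbij (fun x => b.erase x) ?_ ?_ ?_ fun _ _ => rfl
  · intro x hx
    simp only [Finset.mem_filter, Finset.mem_univ, true_and]
    exact ⟨by rw [Finset.card_erase_of_mem hx, hb]; rfl, Finset.erase_subset x b⟩
  · intro x hx y hy hxy
    exact Finset.erase_injOn b hx hy hxy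
  · intro c hc
    simp only [Finset.coe_filter, Finset.mem_univ, true_and, Set.mem_ofPred_eq] at hc
    obtain ⟨x, hx⟩ := Finset.card_eq_one.1
      (show (b \ c).card = 1 by rw [Finset.card_sdiff_of_subset hc.2]; omega)
    have hxb : x ∈ b \ c := hx ▸ Finset.mem_singleton_self x
    refine ⟨x, (Finset.mem_sdiff.1 hxb).1, ?_⟩
    show b.erase x = c
    rw [Finset.erase_eq, ← hx, Finset.sdiff_sdiff_eq_self hc.2]

lemma sum_up_succ_mul (z : Finset V) (F : Finset V → ℝ) :
    ∑ b, K.up z.card (z.card + 1) z b * F b =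
      ∑ x, if x ∈ z then 0 else
        ((n - z.card : ℕ) : ℝ)⁻¹ * (K.mass (insert x z) / K.mass z) * F (insert x z) := by
  rw [← sum_covering z fun b => ((n - z.card : ℕ) : ℝ)⁻¹ * (K.mass b / K.mass z) * F b]
  refine Finset.sum_congr rfl fun b _ => ?_
  unfold up
  by_cases h : b.card = z.card + 1 ∧ z ⊆ b
  · rw [if_pos ⟨rfl, h⟩, if_pos h, Nat.add_sub_cancel_left, Nat.choose_one_right]
  · rw [if_neg fun h' => h h'.2, if_neg h, zero_mul]

lemma linkVertex_of_mem {z : Finset V} {x : V} (hx : x ∈ z) : K.linkVertex z x = 0 := by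
  have h : K.linkMass z {x} = 0 := by
    refine Finset.sum_eq_zero fun β _ => ?_
    split_ifs with hβ
    · refine if_neg fun hd => ?_
      exact Finset.disjoint_left.1 hd (Finset.singleton_subset_iff.1 hβ) hx
    · rfl
  simp [linkVertex, linkLevel, h]

lemma linkVertex_of_notMem {z : Finset V} {x : V} (hx : x ∉ z) :
    K.linkVertex z x = ((n - z.card : ℕ) : ℝ)⁻¹ * (K.mass (insert x z) / K.mass z) := by
  rw [linkVertex, linkLevel, if_pos (Finset.card_singleton x), Nat.choose_one_right,
    K.linkMass_eq (Finset.disjoint_singleton_left.2 hx), Finset.union_comm,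
    ← Finset.insert_eq]

lemma sum_up_succ_mul_eq_sum_linkVertex (z : Finset V) (F : Finset V → ℝ) :
    ∑ b, K.up z.card (z.card + 1) z b * F b = ∑ x, K.linkVertex z x * F (insert x z) := by
  rw [sum_up_succ_mul]
  refine Finset.sum_congr rfl fun x _ => ?_
  split_ifs with h
  · rw [K.linkVertex_of_mem h, zero_mul]
  · rw [K.linkVertex_of_notMem h]

lemma vari_up_succ (z : Finset V) (f : Finset V → ℝ) :
    vari (K.up z.card (z.card + 1) z) f =
      vari (K.linkVertex z) (fun x => f (insert x z)) := by
  rw [vari, vari, K.sum_up_succ_mul_eq_sum_linkVertex z f,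
    K.sum_up_succ_mul_eq_sum_linkVertex z fun b => f b ^ 2]

lemma isProbDist_linkVertex {z : Finset V} (hz : z.card + 1 ≤ n) (hm : K.mass z ≠ 0) :
    IsProbDist (K.linkVertex z) := by
  refine ⟨fun x => K.linkLevel_nonneg z 1 {x}, ?_⟩
  have h := K.sum_up_succ_mul_eq_sum_linkVertex z fun _ => 1
  simp only [mul_one] at h
  rw [← h]
  exact (K.isProbDist_up (Nat.le_succ _) hz hm).2

/-- Joint law of an ordered pair of vertices completing a face of corank two. -/
def linkPair (z : Finset V) (x y : V) : ℝ :=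
  if x ∉ z ∧ y ∉ z ∧ x ≠ y then 2⁻¹ * (K.pi (insert y (insert x z)) / K.mass z) else 0

lemma linkPair_nonneg (z : Finset V) (x y : V) : 0 ≤ K.linkPair z x y := by
  unfold linkPair
  have := K.pi_nonneg (insert y (insert x z))
  have := K.mass_nonneg z
  split_ifs <;> positivity

lemma linkPair_comm (z : Finset V) (x y : V) : K.linkPair z x y = K.linkPair z y x := by
  unfold linkPair
  rw [Finset.insert_comm]
  by_cases h : x ∉ z ∧ y ∉ z ∧ x ≠ y
  · rw [if_pos h, if_pos ⟨h.2.1, h.1, h.2.2.symm⟩]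
  · rw [if_neg h, if_neg fun h' => h ⟨h'.2.1, h'.1, h'.2.2.symm⟩]

lemma sum_pi_insert {b : Finset V} (hb : b.card + 1 = n) :
    ∑ y, (if y ∈ b then 0 else K.pi (insert y b)) = K.mass b := by
  rw [← sum_covering b K.pi]
  have h := K.sum_mass_superset (a := b) (k := b.card + 1) (Nat.le_succ _)
  rw [Nat.add_sub_cancel_left, Nat.choose_one_right,
    show n - b.card = 1 by omega, Nat.cast_one, one_mul] at h
  rw [← h]
  refine Finset.sum_congr rfl fun ω _ => ?_
  split_ifs with hω
  · rw [K.mass_eq_pi (by omega)]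
  · rfl

lemma sum_linkPair {z : Finset V} (hz : z.card + 2 = n) (x : V) :
    ∑ y, K.linkPair z x y = K.linkVertex z x := by
  by_cases hx : x ∈ z
  · rw [K.linkVertex_of_mem hx]
    exact Finset.sum_eq_zero fun y _ => if_neg fun h => h.1 hx
  rw [K.linkVertex_of_notMem hx, show n - z.card = 2 by omega,
    ← K.sum_pi_insert (b := insert x z) (by rw [Finset.card_insert_of_notMem hx]; omega),
    Finset.sum_div, Finset.mul_sum]
  refine Finset.sum_congr rfl fun y _ => ?_
  unfold linkPair
  by_cases hy : y ∈ insert x z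
  · rw [if_pos hy, if_neg fun h => ?_]
    · simp
    · rcases Finset.mem_insert.1 hy with rfl | h'
      · exact h.2.2 rfl
      · exact h.2.1 h'
  · rw [if_neg hy, if_pos]
    · norm_num
    · rw [Finset.mem_insert, not_or] at hy
      exact ⟨hx, hy.2, Ne.symm hy.1⟩

lemma linkVertex_mul_linkMat {z : Finset V} (hz : z.card + 2 = n) (x y : V) :
    K.linkVertex z x * K.linkMat z x y =
      K.linkPair z x y + if y ∈ z then K.linkVertex z x else 0 := by
  by_cases hx : x ∈ z
  · simp [K.linkVertex_of_mem hx, linkPair, hx]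
  rw [K.linkVertex_of_notMem hx, show n - z.card = 2 by omega]
  have hn : (n : ℝ) - z.card - 1 = 1 := by
    rw [← hz]; push_cast; ring
  have hxy : z ∪ {x, y} = insert y (insert x z) := by ext; simp; tauto
  have hx' : z ∪ {x} = insert x z := by rw [Finset.union_comm, ← Finset.insert_eq]
  unfold linkMat linkPair
  rw [hn, hxy, hx']
  by_cases hy : y ∈ z
  · have hne : x ≠ y := fun h => hx (h ▸ hy)
    rw [if_pos hne, if_neg (by tauto), if_pos hy,
      Finset.insert_eq_of_mem (Finset.mem_insert_of_mem hy)]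
    by_cases hm : K.mass (insert x z) = 0
    · simp [hm]
    · rw [div_self hm]; simp
  by_cases hne : x = y
  · simp [hne, hy]
  rw [if_pos hne, if_pos ⟨hx, hy, hne⟩, if_neg hy]
  have hc : (insert y (insert x z)).card = n := by
    rw [Finset.card_insert_of_notMem (by simp [hy, Ne.symm hne]),
      Finset.card_insert_of_notMem hx]
    omega
  rw [← K.mass_eq_pi hc]
  by_cases hm : K.mass (insert x z) = 0
  · rw [K.mass_eq_zero_of_subset (Finset.subset_insert y _) hm]; simp
  · field_simp
    push_cast
    ring

/-- Local Poincaré inequality at a face of corank two. -/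
lemma specGap_mul_vari_up_le {z : Finset V} (hz : z.card + 2 = n) (hm : K.mass z ≠ 0)
    (f : Finset V → ℝ) :
    specGap (K.linkVertex z) (K.linkMat z) * vari (K.up z.card (z.card + 1) z) f ≤
      ∑ x, K.linkVertex z x * f (insert x z) ^ 2 -
        ∑ x, ∑ y, K.linkPair z x y * (f (insert x z) * f (insert y z)) := by
  rw [vari_up_succ]
  refine specGap_mul_vari_le (K.isProbDist_linkVertex (by omega) hm) (K.linkPair_nonneg z)
    (K.linkPair_comm z) (K.sum_linkPair hz) (fun g hg => ?_) (fun x => f (insert x z))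
  simp only [inner', mul_one] at hg
  have h : ∀ x, K.linkVertex z x * (g x * mApp (K.linkMat z) g x) =
      ∑ y, K.linkPair z x y * (g x * g y) +
        K.linkVertex z x * g x * ∑ y, if y ∈ z then g y else 0 := by
    intro x
    rw [mApp, Finset.mul_sum, Finset.mul_sum, Finset.mul_sum, ← Finset.sum_add_distrib]
    refine Finset.sum_congr rfl fun y _ => ?_
    have := K.linkVertex_mul_linkMat hz x y
    split_ifs at this ⊢ <;> linear_combination (g x * g y) * this
  simp only [inner', h, Finset.sum_add_distrib, ← Finset.sum_mul, hg, zero_mul, add_zero]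

lemma sum_down_mul {ω : Finset V} {k : ℕ} (hω : ω.card = k + 1) (f : Finset V → ℝ) :
    ∑ c, K.down (k + 1) k ω c * f c = ((k + 1 : ℕ) : ℝ)⁻¹ * ∑ x ∈ ω, f (ω.erase x) := by
  rw [← sum_covered hω f, Finset.mul_sum]
  refine Finset.sum_congr rfl fun c _ => ?_
  unfold down
  by_cases h : c.card = k ∧ c ⊆ ω
  · rw [if_pos ⟨hω, h⟩, if_pos h, Nat.choose_symm_add, Nat.choose_one_right]
  · rw [if_neg fun h' => h h'.2, if_neg h, zero_mul, mul_zero]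

/-- Sum over ordered pairs of codimension one faces of a common facet. -/
def crossSum (f : Finset V → ℝ) : ℝ :=
  ∑ z : Finset V, ∑ x, if x ∈ z then 0 else
    ∑ y, if y ∈ insert x z then 0 else
      K.pi (insert y (insert x z)) * (f (insert x z) * f (insert y z))

lemma sum_level_mul_linkPair (hn : 2 ≤ n) (f : Finset V → ℝ) :
    ∑ z, K.level (n - 2) z *
        ∑ x, ∑ y, K.linkPair z x y * (f (insert x z) * f (insert y z)) =
      ((n : ℝ) * (n - 1))⁻¹ * K.crossSum f := by
  have hch : (n.choose (n - 2) : ℝ) = n * (n - 1) / 2 := by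
    rw [Nat.choose_symm hn, Nat.cast_choose_two]
  rw [crossSum, Finset.mul_sum]
  refine Finset.sum_congr rfl fun z _ => ?_
  rw [Finset.mul_sum, Finset.mul_sum]
  refine Finset.sum_congr rfl fun x _ => ?_
  by_cases hx : x ∈ z
  · simp [hx, linkPair]
  rw [if_neg hx, Finset.mul_sum, Finset.mul_sum]
  refine Finset.sum_congr rfl fun y _ => ?_
  by_cases hy : y ∈ insert x z
  · have : ¬(x ∉ z ∧ y ∉ z ∧ x ≠ y) := by
      rcases Finset.mem_insert.1 hy with rfl | h <;> tauto
    rw [if_pos hy, linkPair, if_neg this]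
    ring
  have hy' := hy
  rw [Finset.mem_insert, not_or] at hy'
  rw [if_neg hy, linkPair, if_pos ⟨hx, hy'.2, Ne.symm hy'.1⟩]
  have hc : (insert y (insert x z)).card = z.card + 2 := by
    rw [Finset.card_insert_of_notMem hy, Finset.card_insert_of_notMem hx]
  by_cases hz : z.card = n - 2
  · rw [level, if_pos hz, hch]
    by_cases hm : K.mass z = 0
    · have := K.mass_eq_zero_of_subset
        ((Finset.subset_insert x z).trans (Finset.subset_insert y _)) hm
      rw [K.mass_eq_pi (by omega)] at this
      simp [this]
    · have hn0 : (2 : ℝ) ≤ n := by exact_mod_cast hn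
      have h1 : (n : ℝ) ≠ 0 := by linarith
      have h2 : (n : ℝ) - 1 ≠ 0 := by linarith
      field_simp
  · rw [level, if_neg hz, K.pi_zero_of_card_ne _ (by omega)]
    simp

lemma inner'_upDown (hn : 1 ≤ n) (f : Finset V → ℝ) :
    inner' (K.level (n - 1)) f (mApp (K.upDown (n - 1)) f) =
      (n : ℝ)⁻¹ * ∑ b, K.level (n - 1) b * f b ^ 2 + ((n : ℝ) ^ 2)⁻¹ * K.crossSum f := by
  obtain ⟨k, rfl⟩ : ∃ k, n = k + 1 := ⟨n - 1, by omega⟩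
  rw [Nat.add_sub_cancel]
  have h1 : ∀ b : Finset V, K.level k b * (f b * mApp (K.upDown k) f b) =
      (((k + 1 : ℕ) : ℝ) ^ 2)⁻¹ * ∑ y, if y ∈ b then 0 else
        K.pi (insert y b) * (f b * (f b + ∑ x ∈ b, f ((insert y b).erase x))) := by
    intro b
    have hm : mApp (K.upDown k) f b =
        ∑ ω, K.up k (k + 1) b ω * ∑ c, K.down (k + 1) k ω c * f c := by
      simp only [mApp, upDown, matMul, Finset.sum_mul, Finset.mul_sum]
      rw [Finset.sum_comm]
      simp only [mul_assoc]
    by_cases hb : b.card = k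
    · subst hb
      rw [hm, K.sum_up_succ_mul, Nat.add_sub_cancel_left, Finset.mul_sum, Finset.mul_sum,
        Finset.mul_sum]
      refine Finset.sum_congr rfl fun y _ => ?_
      split_ifs with hy
      · simp
      have hc : (insert y b).card = b.card + 1 := Finset.card_insert_of_notMem hy
      rw [K.sum_down_mul hc, Finset.sum_insert hy, Finset.erase_insert hy, level, if_pos rfl,
        Nat.choose_symm_add, Nat.choose_one_right, K.mass_eq_pi hc]
      by_cases h0 : K.mass b = 0
      · have := K.mass_eq_zero_of_subset (Finset.subset_insert y b) h0
        rw [K.mass_eq_pi hc] at this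
        simp [this]
      · have : ((b.card + 1 : ℕ) : ℝ) ≠ 0 := by positivity
        field_simp
        simp
    · rw [level, if_neg hb, zero_mul, Finset.sum_eq_zero, mul_zero]
      intro y _
      split_ifs with hy
      · rfl
      · rw [K.pi_zero_of_card_ne, zero_mul]
        rw [Finset.card_insert_of_notMem hy]
        omega
  have h2 : ∀ b : Finset V, ∑ y, (if y ∈ b then 0 else
        K.pi (insert y b) * (f b * (f b + ∑ x ∈ b, f ((insert y b).erase x)))) =
      ((k + 1 : ℕ) : ℝ) * (K.level k b * f b ^ 2) +
        ∑ x, if x ∈ b then ∑ y, if y ∈ b then 0 else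
          K.pi (insert y b) * (f b * f (insert y (b.erase x))) else 0 := by
    intro b
    have e1 : ((k + 1 : ℕ) : ℝ) * (K.level k b * f b ^ 2) =
        ∑ y, if y ∈ b then 0 else K.pi (insert y b) * f b ^ 2 := by
      by_cases hb : b.card = k
      · rw [level, if_pos hb, ← K.sum_pi_insert (by omega), Nat.choose_symm_add,
          Nat.choose_one_right, ← mul_assoc, mul_inv_cancel_left₀ (by positivity),
          Finset.sum_mul]
        simp only [ite_mul, zero_mul]
      · rw [level, if_neg hb, zero_mul, mul_zero, Finset.sum_eq_zero]
        intro y _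
        split_ifs with hy
        · rfl
        · rw [K.pi_zero_of_card_ne, zero_mul]
          rw [Finset.card_insert_of_notMem hy]
          omega
    have e2 : (∑ x, if x ∈ b then ∑ y, if y ∈ b then 0 else
          K.pi (insert y b) * (f b * f (insert y (b.erase x))) else 0) =
        ∑ y, if y ∈ b then 0 else
          K.pi (insert y b) * (f b * ∑ x ∈ b, f ((insert y b).erase x)) := by
      rw [← Finset.sum_filter, Finset.sum_comm]
      refine Finset.sum_congr rfl fun y _ => ?_
      split_ifs with hy
      · simp
      · rw [Finset.filter_mem_eq_inter, Finset.univ_inter, Finset.mul_sum, Finset.mul_sum]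
        refine Finset.sum_congr rfl fun x hx => ?_
        rw [Finset.erase_insert_of_ne fun h : y = x => hy (h ▸ hx)]
    rw [e1, e2, ← Finset.sum_add_distrib]
    refine Finset.sum_congr rfl fun y _ => ?_
    split_ifs <;> ring
  have h3 : K.crossSum f = ∑ b : Finset V, ∑ x, if x ∈ b then ∑ y, if y ∈ b then 0 else
      K.pi (insert y b) * (f b * f (insert y (b.erase x))) else 0 := by
    rw [← sum_insert_eq_sum_erase fun b x => ∑ y, if y ∈ b then 0 else
      K.pi (insert y b) * (f b * f (insert y (b.erase x)))]
    refine Finset.sum_congr rfl fun z _ => Finset.sum_congr rfl fun x _ => ?_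
    split_ifs with hx
    · rfl
    · rw [Finset.erase_insert hx]
  simp only [inner', h1, h2]
  rw [← Finset.mul_sum, Finset.sum_add_distrib, ← h3, ← Finset.mul_sum]
  have : ((k + 1 : ℕ) : ℝ) ≠ 0 := by positivity
  field_simp

/-- Log-Sobolev inequality for the up-down walk on the faces of corank one. -/
lemma gap_mul_EC_le_LS_upDown (hn : 2 ≤ n) :
    (((n : ℝ) - 1) / n) *
          sInf {r | ∃ z ∈ K.faces, z.card = n - 2 ∧ r = Cconst K z 1} *
          sInf {r | ∃ z ∈ K.faces, z.card = n - 2 ∧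
              r = specGap (K.linkVertex z) (K.linkMat z)} *
          EC (K.level (n - 2)) (K.level (n - 1)) (K.up (n - 2) (n - 1)) ≤
        LS (K.level (n - 1)) (K.upDown (n - 1)) := by
  set G := sInf {r | ∃ z ∈ K.faces, z.card = n - 2 ∧
    r = specGap (K.linkVertex z) (K.linkMat z)} with hG
  have hn1 : n - 2 ≤ n - 1 := by omega
  have hnn : n - 1 ≤ n := by omega
  have hn0 : (2 : ℝ) ≤ n := by exact_mod_cast hn
  have hcoef : (0 : ℝ) ≤ ((n : ℝ) - 1) / n := div_nonneg (by linarith) (by linarith)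
  have hC := K.sInf_Cconst_nonneg (n - 2) 1
  rcases le_or_gt G 0 with hG0 | hG0
  · exact (mul_nonpos_of_nonpos_of_nonneg (mul_nonpos_of_nonneg_of_nonpos
      (mul_nonneg hcoef hC) hG0) (EC_nonneg _ _ _)).trans (LS_nonneg _ _)
  refine mul_EC_le_LS (K.level_nonneg _) (K.isProbDist_up_of_level_ne_zero hn1 hnn)
    (K.sum_level_mul_up hn1 hnn) fun f hf => ?_
  have hent := K.sInf_Cconst_mul_ent_le hn1 hnn hf
  rw [show n - 1 - (n - 2) = 1 by omega] at hent
  have hloc : G * ∑ z, K.level (n - 2) z * vari (K.up (n - 2) (n - 1) z) f ≤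
      ∑ z, K.level (n - 2) z * (∑ b, K.up (n - 2) (n - 1) z b * f b ^ 2 -
        ∑ x, ∑ y, K.linkPair z x y * (f (insert x z) * f (insert y z))) := by
    rw [Finset.mul_sum]
    refine Finset.sum_le_sum fun z _ => ?_
    by_cases hz : K.level (n - 2) z = 0
    · simp [hz]
    have hzc : z.card = n - 2 := by
      by_contra h
      exact hz (if_neg h)
    have hzm : K.mass z ≠ 0 := fun h => hz (by simp [level, h])
    have hle : G ≤ specGap (K.linkVertex z) (K.linkMat z) := by
      refine csInf_le (Set.Finite.bddBelow ?_) ⟨z, K.mem_faces_of_mass_ne_zero hzm, hzc, rfl⟩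
      refine (K.faces.finite_toSet.image fun z =>
        specGap (K.linkVertex z) (K.linkMat z)).subset ?_
      rintro _ ⟨w, hw, -, rfl⟩
      exact ⟨w, hw, rfl⟩
    have hP := K.isProbDist_up_of_level_ne_zero hn1 hnn z hz
    have h1 := K.specGap_mul_vari_up_le (by omega) hzm f
    rw [← K.sum_up_succ_mul_eq_sum_linkVertex z fun b => f b ^ 2,
      show z.card + 1 = n - 1 by omega, hzc] at h1
    have h2 := (mul_le_mul_of_nonneg_right hle (vari_nonneg hP (f := f))).trans h1
    have h3 := mul_le_mul_of_nonneg_left h2 (K.level_nonneg (n - 2) z)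
    linarith
  have hsq : ∑ z, K.level (n - 2) z * ∑ b, K.up (n - 2) (n - 1) z b * f b ^ 2 =
      ∑ b, K.level (n - 1) b * f b ^ 2 := by
    simp only [← K.sum_level_mul_up hn1 hnn, Finset.sum_mul, Finset.mul_sum]
    rw [Finset.sum_comm]
    simp only [mul_assoc]
  simp only [mul_sub, Finset.sum_sub_distrib] at hloc
  rw [hsq, K.sum_level_mul_linkPair hn f] at hloc
  have hsplit : inner' (K.level (n - 1)) f (fun x => f x - mApp (K.upDown (n - 1)) f x) =
      ∑ b, K.level (n - 1) b * f b ^ 2 -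
        inner' (K.level (n - 1)) f (mApp (K.upDown (n - 1)) f) := by
    simp only [inner', ← Finset.sum_sub_distrib]
    exact Finset.sum_congr rfl fun b _ => by ring
  rw [hsplit, K.inner'_upDown (by omega) f]
  set C := sInf {r | ∃ z ∈ K.faces, z.card = n - 2 ∧ r = Cconst K z 1}
  set A := ∑ b, K.level (n - 1) b * f b ^ 2
  calc _ = ((n : ℝ) - 1) / n * (G * (C * ∑ z, K.level (n - 2) z *
          ent (K.up (n - 2) (n - 1) z) (fun x => f x ^ 2))) := by ring
    _ ≤ ((n : ℝ) - 1) / n * (A - ((n : ℝ) * (n - 1))⁻¹ * K.crossSum f) :=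
      mul_le_mul_of_nonneg_left
        ((mul_le_mul_of_nonneg_left hent hG0.le).trans hloc) hcoef
    _ = _ := by
      have h1 : (n : ℝ) - 1 ≠ 0 := by linarith
      have h2 : (n : ℝ) ≠ 0 := by linarith
      field_simp
      ring

end UpDown

end WComplex

end Expanderized

open Expanderized WComplex in
/-- (1) `LS(Duw_{n↔ℓ}) ≥ (min_{ω̂ ∈ X^(ℓ)} C_{ω̂,n−ℓ})·EC(Up_{ℓ→n})`;
(2) `LS(Udw_{n−1↔n}) ≥ ((n−1)/n)·(min_{ω̂ ∈ X^(n−2)} C_{ω̂,1})·Gap_{n−2}(X,π)·EC(Up_{n−2→n−1})`. -/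
theorem statement9 {V : Type*} [Fintype V] [DecidableEq V] {n ℓ : ℕ}
    (K : WComplex V n) (hn : 2 ≤ n) (hℓ : ℓ ≤ n) :
    (sInf {r | ∃ z ∈ K.faces, z.card = ℓ ∧ r = Cconst K z (n - ℓ)} *
          EC (K.level ℓ) K.pi (K.up ℓ n) ≤
        LS K.pi (K.downUp ℓ)) ∧
      ((((n : ℝ) - 1) / n) *
            sInf {r | ∃ z ∈ K.faces, z.card = n - 2 ∧ r = Cconst K z 1} *
            sInf {r | ∃ z ∈ K.faces, z.card = n - 2 ∧
                r = specGap (K.linkVertex z) (K.linkMat z)} *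
            EC (K.level (n - 2)) (K.level (n - 1)) (K.up (n - 2) (n - 1)) ≤
          LS (K.level (n - 1)) (K.upDown (n - 1))) := by
  exact ⟨K.sInf_Cconst_mul_EC_le_LS_downUp hℓ, K.gap_mul_EC_le_LS_upDown hn⟩
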